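/- arXiv:2308.11820 — 2 statements merged into one kernel-verified Lean document; each statement's English description precedes it below -/
import Mathlib

section
/- If u is a strong solution of ∂_t u = (1/2) u ∂_x² u on a time interval [0,T), then for all 0 < T₁ ≤ T₂ < T one has sup_{t∈[T₁,T₂]} Lip √u(t,·) < ∞. If moreover u(0,·) is differentiable with Lipschitz derivative, then the same conclusion holds with T₁ = 0. -/
open MeasureTheory Set Filter

noncomputable section

/-- Regularity requirements in the definition of a weak solution of
`∂ₜ u = (1/2) u ∂ₓ² u` on `[0,T) × ℝ`: continuity on `[0,T) × ℝ`, local Lipschitz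
continuity of `u(t,·)`, and continuity of `t ↦ u(t,·)` into `W^{1,∞}_loc(ℝ)`. -/
def RegWeak (T : ℝ) (u : ℝ → ℝ → ℝ) : Prop :=
  ContinuousOn (Function.uncurry u) (Ico 0 T ×ˢ (univ : Set ℝ)) ∧
  (∀ t ∈ Ico (0:ℝ) T, ∀ R : ℝ, 0 < R →
    ∃ L : NNReal, LipschitzOnWith L (u t) (Icc (-R) R)) ∧
  (∀ t₀ ∈ Ico (0:ℝ) T, ∀ R : ℝ, 0 < R →
    Tendsto (fun t => ⨆ x : Icc (-R) R,
        (|u t x.1 - u t₀ x.1| + |deriv (u t) x.1 - deriv (u t₀) x.1|))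
      (nhdsWithin t₀ (Ico 0 T)) (nhds 0))

/-- The weak (integral) formulation of `∂ₜ u = (1/2) u ∂ₓ² u` on `[0,T) × ℝ`,
tested against every `ψ ∈ C_c^∞([0,T) × ℝ)`. -/
def WeakForm (T : ℝ) (u : ℝ → ℝ → ℝ) : Prop :=
  ∀ ψ : ℝ → ℝ → ℝ,
    ContDiff ℝ (⊤ : ℕ∞) (Function.uncurry ψ) →
    HasCompactSupport (Function.uncurry ψ) →
    tsupport (Function.uncurry ψ) ⊆ Iio T ×ˢ (univ : Set ℝ) →
    (∫ x : ℝ, u 0 x * ψ 0 x) +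
      (∫ t in Ico (0:ℝ) T, ∫ x : ℝ,
        (u t x * deriv (fun s => ψ s x) t
          - (1/2) * deriv (fun y => ψ t y * u t y) x * deriv (u t) x)) = 0

/-- A weak solution of `∂ₜ u = (1/2) u ∂ₓ² u` on `[0,T) × ℝ`. -/
def IsWeakSolution (T : ℝ) (u : ℝ → ℝ → ℝ) : Prop :=
  (∀ t ∈ Ico (0:ℝ) T, ∀ x : ℝ, 0 ≤ u t x) ∧ RegWeak T u ∧ WeakForm T u

/-- `sup_{[0,T']×ℝ} ⟨x⟩⁻² u < ∞`, i.e. `u(t,x) ≤ M (x²+1)` on `[0,T'] × ℝ`. -/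
def QuadBoundOn (u : ℝ → ℝ → ℝ) (T' : ℝ) : Prop :=
  ∃ M : ℝ, ∀ t ∈ Icc (0:ℝ) T', ∀ x : ℝ, u t x ≤ M * (x ^ 2 + 1)

/-- For a.e. `t ∈ (0,T']` the function `u(t,·)` is twice differentiable, and
`t ↦ ess sup_x |∂ₓ² u(t,x)|` is integrable on `[0,T']` (expressed via an
integrable majorant `g`). -/
def SecondDerivIntegrableOn (u : ℝ → ℝ → ℝ) (T' : ℝ) : Prop :=
  ∃ g : ℝ → ℝ, IntegrableOn g (Icc (0:ℝ) T') ∧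
    ∀ᵐ t ∂(volume.restrict (Ioc (0:ℝ) T')),
      (∀ x : ℝ, DifferentiableAt ℝ (u t) x ∧ DifferentiableAt ℝ (deriv (u t)) x) ∧
      (∀ x : ℝ, |deriv (deriv (u t)) x| ≤ g t)

/-- A strong solution of `∂ₜ u = (1/2) u ∂ₓ² u` on `[0,T) × ℝ`. -/
def IsStrongSolution (T : ℝ) (u : ℝ → ℝ → ℝ) : Prop :=
  IsWeakSolution T u ∧
  ∀ T' : ℝ, 0 < T' → T' < T → QuadBoundOn u T' ∧ SecondDerivIntegrableOn u T'

open Topology Function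

/-- A nonnegative continuous function satisfying a local Lipschitz bound at each point where it is
positive is Lipschitz. -/
lemma le_add_of_eventually_slope_le {f : ℝ → ℝ} (hf : Continuous f) (h0 : ∀ x, 0 ≤ f x) {C : ℝ}
    (hC : 0 ≤ C) (h : ∀ x, 0 < f x → ∀ᶠ y in 𝓝 x, |f y - f x| ≤ C * |y - x|) {x y : ℝ}
    (hxy : x ≤ y) : f y ≤ f x + C * (y - x) := by
  refine le_of_forall_pos_le_add fun δ hδ => ?_
  have key : Icc x y ⊆ {s | f s ≤ f x + δ + C * (s - x)} := by
    refine IsClosed.Icc_subset_of_forall_exists_gt ?_ ?_ ?_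
    · exact (isClosed_le hf (by fun_prop)).inter isClosed_Icc
    · simp [hδ.le]
    · rintro s ⟨hs, hsx, hsy⟩ z hz
      have hz' : s < z := hz
      suffices H : ∀ᶠ r in 𝓝[>] s, f r ≤ f x + δ + C * (r - x) by
        obtain ⟨r, hr, hr'⟩ := (H.and (Ioc_mem_nhdsGT hz')).exists
        exact ⟨r, hr, hr'⟩
      have hs' : f s ≤ f x + δ + C * (s - x) := hs
      rcases (h0 s).eq_or_lt with h0s | h0s
      · have h1 : f s < f x + δ := by rw [← h0s]; linarith [h0 x]
        have h2 : ∀ᶠ r in 𝓝[>] s, f r < f x + δ :=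
          (hf.continuousAt.eventually_lt continuousAt_const h1).filter_mono nhdsWithin_le_nhds
        filter_upwards [h2, self_mem_nhdsWithin] with r hr hr'
        have : s < r := hr'
        have : 0 ≤ C * (r - x) := mul_nonneg hC (by linarith)
        linarith
      · filter_upwards [(h s h0s).filter_mono nhdsWithin_le_nhds, self_mem_nhdsWithin] with r hr hr'
        have h3 : s < r := hr'
        rw [abs_of_pos (sub_pos.2 h3)] at hr
        have := (abs_le.1 hr).2
        linarith
  have : f y ≤ f x + δ + C * (y - x) := key (right_mem_Icc.2 hxy)
  linarith

lemma lipschitzWith_of_eventually_slope_le {f : ℝ → ℝ} (hf : Continuous f) (h0 : ∀ x, 0 ≤ f x)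
    {C : NNReal} (h : ∀ x, 0 < f x → ∀ᶠ y in 𝓝 x, |f y - f x| ≤ C * |y - x|) :
    LipschitzWith C f := by
  have hle : ∀ x y, x ≤ y → |f x - f y| ≤ C * |x - y| := by
    intro x y hxy
    have h1 := le_add_of_eventually_slope_le hf h0 C.2 h hxy
    have h2 := le_add_of_eventually_slope_le (f := fun z => f (-z)) (hf.comp continuous_neg)
      (fun z => h0 _) C.2 (fun z hz => by
        have := (continuous_neg.tendsto z).eventually (h (-z) hz)
        filter_upwards [this] with w hw
        rwa [show -w - -z = -(w - z) by ring, abs_neg] at hw) (neg_le_neg hxy)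
    simp only [neg_neg] at h2
    rw [abs_sub_comm x y, abs_of_nonneg (sub_nonneg.2 hxy), abs_le]
    change _ ≤ _ + (C : ℝ) * _ at h1
    change _ ≤ _ + (C : ℝ) * _ at h2
    constructor <;> linarith
  refine LipschitzWith.of_dist_le_mul fun x y => ?_
  rw [Real.dist_eq, Real.dist_eq]
  rcases le_total x y with hxy | hxy
  · exact hle x y hxy
  · rw [abs_sub_comm, abs_sub_comm x y]
    exact hle y x hxy

/-- A nonnegative differentiable function with Lipschitz derivative has a Lipschitz square root. -/
lemma exists_lipschitzWith_sqrt {f : ℝ → ℝ} (h0 : ∀ x, 0 ≤ f x) (hf : Differentiable ℝ f)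
    {L : NNReal} (hL : LipschitzWith L (deriv f)) :
    ∃ M : NNReal, LipschitzWith M (fun x => √(f x)) := by
  have hsq : ∀ x, (deriv f x) ^ 2 ≤ 4 * L * f x := by
    intro x
    have hT : ∀ h : ℝ, 0 ≤ (L : ℝ) * (h * h) + deriv f x * h + f x := by
      intro h
      have hLip : LipschitzOnWith (L * ‖h‖₊) (fun y => f y - deriv f x * y)
          (Metric.closedBall x |h|) := by
        refine Convex.lipschitzOnWith_of_nnnorm_deriv_le (𝕜 := ℝ) (fun y _ => by fun_prop) ?_
          (convex_closedBall _ _)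
        intro y hy
        rw [deriv_fun_sub (by fun_prop) (by fun_prop), deriv_const_mul_field,
          show deriv (fun y : ℝ => y) y = 1 from deriv_id y, mul_one]
        have h1 := hL.dist_le_mul y x
        rw [Metric.mem_closedBall] at hy
        rw [Real.dist_eq] at h1
        rw [← NNReal.coe_le_coe]
        simp only [coe_nnnorm, Real.norm_eq_abs, NNReal.coe_mul]
        exact h1.trans (mul_le_mul_of_nonneg_left hy L.2)
      have h2 := hLip.dist_le_mul (x + h) (by simp) x (by simp)
      simp only [Real.dist_eq, NNReal.coe_mul, coe_nnnorm, Real.norm_eq_abs, add_sub_cancel_left]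
        at h2
      rw [mul_assoc, abs_mul_abs_self] at h2
      have h3 := (abs_le.1 h2).2
      nlinarith [h0 (x + h)]
    have := discrim_le_zero hT
    rw [discrim] at this
    linarith
  refine ⟨NNReal.sqrt L + 1, lipschitzWith_of_eventually_slope_le
    (Real.continuous_sqrt.comp hf.continuous) (fun x => Real.sqrt_nonneg _) fun x hx => ?_⟩
  have hfx : 0 < f x := Real.sqrt_pos.1 hx
  have hd : HasDerivAt (fun x => √(f x)) (deriv f x / (2 * √(f x))) x :=
    (hf x).hasDerivAt.sqrt hfx.ne'
  have hb : |deriv f x / (2 * √(f x))| ≤ √L := by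
    rw [abs_div, abs_of_pos (by positivity : 0 < 2 * √(f x)), div_le_iff₀ (by positivity)]
    refine abs_le_of_sq_le_sq ?_ (by positivity)
    calc (deriv f x) ^ 2 ≤ 4 * L * f x := hsq x
      _ = _ := by
        rw [mul_pow, mul_pow, Real.sq_sqrt L.coe_nonneg, Real.sq_sqrt hfx.le]; ring
  have ho := (hasDerivAt_iff_isLittleO.1 hd).bound one_pos
  filter_upwards [ho] with y hy
  simp only [Real.norm_eq_abs, smul_eq_mul, one_mul] at hy
  have h1 : |(y - x) * (deriv f x / (2 * √(f x)))| ≤ √L * |y - x| := by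
    rw [abs_mul, mul_comm]
    exact mul_le_mul_of_nonneg_right hb (abs_nonneg _)
  change |√(f y) - √(f x)| ≤ _
  push_cast
  have h2 := abs_add_le (√(f y) - √(f x) - (y - x) * (deriv f x / (2 * √(f x))))
    ((y - x) * (deriv f x / (2 * √(f x))))
  rw [sub_add_cancel] at h2
  linarith

lemma IsLocalMax.deriv_deriv_nonpos {f : ℝ → ℝ} {x : ℝ} (h : IsLocalMax f x)
    (hf : ContinuousAt f x) : deriv (deriv f) x ≤ 0 := by
  by_contra! hpos
  have hmin := isLocalMin_of_deriv_deriv_pos hpos h.deriv_eq_zero hf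
  have hc : f =ᶠ[𝓝 x] fun _ => f x := by
    filter_upwards [h, hmin] with y h1 h2 using le_antisymm h1 h2
  have h1 : deriv f =ᶠ[𝓝 x] fun _ => 0 := by
    have := hc.deriv
    simpa using this
  have := h1.deriv_eq
  simp at this
  linarith

lemma second_deriv_le_of_isLocalMax_sub {f f₁ : ℝ → ℝ} {f₂ x α β γ : ℝ}
    (hf₁ : ∀ z, HasDerivAt f (f₁ z) z) (hf₂ : HasDerivAt f₁ f₂ x)
    (hmax : IsLocalMax (fun z => f z - (α * z ^ 2 + β * z + γ)) x) : f₂ ≤ 2 * α := by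
  have h₁ : ∀ z, HasDerivAt (fun z => f z - (α * z ^ 2 + β * z + γ))
      (f₁ z - (α * (2 * z) + β)) z := fun z => by
    refine (hf₁ z).sub ?_
    simpa using ((((hasDerivAt_id z).pow 2).const_mul α).add
      ((hasDerivAt_id z).const_mul β)).add_const γ
  have h₂ : HasDerivAt (deriv fun z => f z - (α * z ^ 2 + β * z + γ)) (f₂ - 2 * α) x := by
    rw [show deriv (fun z => f z - (α * z ^ 2 + β * z + γ)) = _ from funext fun z => (h₁ z).deriv]
    refine hf₂.sub ?_
    simpa [mul_comm] using (((hasDerivAt_id x).const_mul 2).const_mul α).add_const β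
  have := hmax.deriv_deriv_nonpos (h₁ x).continuousAt
  rw [h₂.deriv] at this
  linarith

set_option maxHeartbeats 1000000 in
/-- Kruzhkov's doubling of variables: an interior Lipschitz bound, independent of the modulus of
continuity and of the ellipticity of `a`, for approximate solutions of `∂ₜ w = (1/2) a ∂ₓ² w`. -/
lemma sub_le_of_approx_heat {w w₁ w₂ a : ℝ → ℝ → ℝ} {h : ℝ → ℝ} {t₀ t₁ x₀ r N L₀ M : ℝ}
    (hr : 0 < r) (hN : 0 ≤ N) (hM : 2 * L₀ ≤ M) (hM' : 4 * N / r ≤ M)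
    (hw : ContinuousOn (uncurry w) (Icc t₀ t₁ ×ˢ univ))
    (hw₁ : ∀ t ∈ Icc t₀ t₁, ∀ x, HasDerivAt (w t) (w₁ t x) x)
    (hw₂ : ∀ t ∈ Icc t₀ t₁, ∀ x, HasDerivAt (w₁ t) (w₂ t x) x)
    (hw₂c : ∀ x, ContinuousOn (fun t => w₂ t x) (Icc t₀ t₁))
    (hac : ∀ x, ContinuousOn (fun t => a t x) (Icc t₀ t₁))
    (ha : ∀ t ∈ Icc t₀ t₁, ∀ x, 0 ≤ a t x)
    (hh : ContinuousOn h (Icc t₀ t₁))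
    (heq : ∀ x ∈ Icc (x₀ - r) (x₀ + r), ∀ s ∈ Icc t₀ t₁, ∀ t ∈ Icc t₀ t₁, s ≤ t →
      |w t x - w s x - ∫ τ in s..t, 1 / 2 * (a τ x * w₂ τ x)| ≤ h t - h s)
    (hosc : ∀ t ∈ Icc t₀ t₁, ∀ x ∈ Icc (x₀ - r) (x₀ + r), ∀ y ∈ Icc (x₀ - r) (x₀ + r),
      w t x - w t y ≤ N)
    (hinit : ∀ x ∈ Icc (x₀ - r) (x₀ + r), ∀ y ∈ Icc (x₀ - r) (x₀ + r), y ≤ x →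
      w t₀ x - w t₀ y ≤ L₀ * (x - y))
    {t x y : ℝ} (ht : t ∈ Icc t₀ t₁) (hx : x ∈ Icc (x₀ - r) (x₀ + r))
    (hy : y ∈ Icc (x₀ - r) (x₀ + r)) (hxy : y ≤ x) :
    w t x - w t y ≤ M * (x - y) + N / r ^ 2 * ((x - x₀) ^ 2 + (y - x₀) ^ 2)
      + 2 * (h t - h t₀) := by
  have ht₀ : t₀ ∈ Icc t₀ t₁ := left_mem_Icc.2 (ht.1.trans ht.2)
  have hx₀ : x₀ ∈ Icc (x₀ - r) (x₀ + r) := ⟨by linarith, by linarith⟩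
  have hmono : ∀ s ∈ Icc t₀ t₁, h t₀ ≤ h s := fun s hs => by
    have := (abs_nonneg _).trans (heq x₀ hx₀ t₀ ht₀ s hs hs.1)
    linarith
  have hM0 : 0 ≤ M := le_trans (by positivity) hM'
  set B : ℝ → ℝ → ℝ := fun x y =>
    M * ((x - y) - (x - y) ^ 2 / (4 * r)) + N / r ^ 2 * ((x - x₀) ^ 2 + (y - x₀) ^ 2) with hB
  have hK : 0 ≤ N / r ^ 2 := by positivity
  have hψ : ∀ z, 0 ≤ z → z ≤ 2 * r → z / 2 ≤ z - z ^ 2 / (4 * r) := by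
    intro z hz hz'
    have : z ^ 2 / (4 * r) ≤ z / 2 := by
      rw [div_le_div_iff₀ (by positivity) (by positivity)]
      nlinarith
    linarith
  suffices H : ∀ η > 0, ∀ t ∈ Icc t₀ t₁, ∀ x ∈ Icc (x₀ - r) (x₀ + r),
      ∀ y ∈ Icc (x₀ - r) (x₀ + r), y ≤ x →
      w t x - w t y - B x y - 2 * (h t - h t₀) - η * (t - t₀) ≤ 0 by
    refine le_of_forall_pos_le_add fun δ hδ => ?_
    have h1 := H (δ / (t - t₀ + 1)) (div_pos hδ (by linarith [ht.1])) t ht x hx y hy hxy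
    have h2 : δ / (t - t₀ + 1) * (t - t₀) ≤ δ := by
      rw [div_mul_eq_mul_div, div_le_iff₀ (by linarith [ht.1])]
      nlinarith [ht.1]
    have h3 : B x y ≤ M * (x - y) + N / r ^ 2 * ((x - x₀) ^ 2 + (y - x₀) ^ 2) := by
      have : 0 ≤ M * ((x - y) ^ 2 / (4 * r)) := by positivity
      simp only [hB]
      linarith
    linarith
  intro η hη
  set Φ : ℝ × ℝ × ℝ → ℝ := fun p =>
    w p.1 p.2.1 - w p.1 p.2.2 - B p.2.1 p.2.2 - 2 * (h p.1 - h t₀) - η * (p.1 - t₀) with hΦ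
  set S : Set (ℝ × ℝ × ℝ) := (Icc t₀ t₁ ×ˢ Icc (x₀ - r) (x₀ + r) ×ˢ Icc (x₀ - r) (x₀ + r)) ∩
    {p | p.2.2 ≤ p.2.1} with hS
  have hScomp : IsCompact S :=
    (isCompact_Icc.prod (isCompact_Icc.prod isCompact_Icc)).inter_right
      (isClosed_le (by fun_prop) (by fun_prop))
  have hΦc : ContinuousOn Φ S := by
    have c1 : ContinuousOn (fun p : ℝ × ℝ × ℝ => w p.1 p.2.1) S :=
      hw.comp (f := fun p : ℝ × ℝ × ℝ => (p.1, p.2.1)) (by fun_prop) fun p hp => ⟨hp.1.1, trivial⟩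
    have c2 : ContinuousOn (fun p : ℝ × ℝ × ℝ => w p.1 p.2.2) S :=
      hw.comp (f := fun p : ℝ × ℝ × ℝ => (p.1, p.2.2)) (by fun_prop) fun p hp => ⟨hp.1.1, trivial⟩
    have c3 : ContinuousOn (fun p : ℝ × ℝ × ℝ => h p.1) S :=
      hh.comp (f := fun p : ℝ × ℝ × ℝ => p.1) (by fun_prop) fun p hp => hp.1.1
    have c4 : ContinuousOn (fun p : ℝ × ℝ × ℝ => B p.2.1 p.2.2) S := by
      simp only [hB]
      fun_prop
    have c5 : ContinuousOn (fun p : ℝ × ℝ × ℝ => 2 * (h p.1 - h t₀)) S :=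
      continuousOn_const.mul (c3.sub continuousOn_const)
    have c6 : ContinuousOn (fun p : ℝ × ℝ × ℝ => η * (p.1 - t₀)) S := by fun_prop
    exact (((c1.sub c2).sub c4).sub c5).sub c6
  obtain ⟨⟨t', x', y'⟩, hmem, hmax⟩ := hScomp.exists_isMaxOn
    ⟨(t₀, x₀, x₀), ⟨ht₀, hx₀, hx₀⟩, le_refl x₀⟩ hΦc
  obtain ⟨⟨ht', hx', hy'⟩, hxy'⟩ := hmem
  simp only at ht' hx' hy'
  replace hxy' : y' ≤ x' := hxy'
  suffices HH : Φ (t', x', y') ≤ 0 from fun t ht x hx y hy hxy =>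
    (hmax (show (t, x, y) ∈ S from ⟨⟨ht, hx, hy⟩, hxy⟩)).trans HH
  by_contra! hpos
  have hval : 0 < w t' x' - w t' y' - B x' y' - 2 * (h t' - h t₀) - η * (t' - t₀) := hpos
  have hht := hmono t' ht'
  have hηt : 0 ≤ η * (t' - t₀) := mul_nonneg hη.le (by linarith [ht'.1])
  have hψ' := hψ (x' - y') (by linarith) (by linarith [hx'.2, hy'.1])
  have hMψ : 0 ≤ M * ((x' - y') - (x' - y') ^ 2 / (4 * r)) :=
    mul_nonneg hM0 (by linarith)
  have hKnn : 0 ≤ N / r ^ 2 * ((x' - x₀) ^ 2 + (y' - x₀) ^ 2) := by positivity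
  have hBnn : 0 ≤ B x' y' := by simp only [hB]; linarith
  have hlt : y' < x' := by
    rcases hxy'.eq_or_lt with he | hl
    · rw [he] at hval hBnn; linarith
    · exact hl
  have ht'0 : t₀ < t' := by
    rcases ht'.1.eq_or_lt with he | hl
    · have h1 := hinit x' hx' y' hy' hxy'
      rw [← he] at hval
      have h2 : L₀ * (x' - y') ≤ M * ((x' - y') - (x' - y') ^ 2 / (4 * r)) := by
        nlinarith
      simp only [hB] at hval
      linarith
    · exact hl
  have hosc' := hosc t' ht' x' hx' y' hy'
  have hinter : (x' - x₀) ^ 2 + (y' - x₀) ^ 2 < r ^ 2 := by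
    by_contra! hge
    have : N ≤ N / r ^ 2 * ((x' - x₀) ^ 2 + (y' - x₀) ^ 2) := by
      calc N = N / r ^ 2 * r ^ 2 := by field_simp
        _ ≤ _ := mul_le_mul_of_nonneg_left hge hK
    simp only [hB] at hval
    linarith
  have hx'i := abs_lt.1 (abs_lt_of_sq_lt_sq (by nlinarith [sq_nonneg (y' - x₀)]) hr.le :
    |x' - x₀| < r)
  have hy'i := abs_lt.1 (abs_lt_of_sq_lt_sq (by nlinarith [sq_nonneg (x' - x₀)]) hr.le :
    |y' - x₀| < r)
  have hbal : 2 * (N / r ^ 2) - M / (2 * r) ≤ 0 := by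
    have : M / (2 * r) ≥ 4 * N / r / (2 * r) := by gcongr
    have h2 : 4 * N / r / (2 * r) = 2 * (N / r ^ 2) := by field_simp; ring
    linarith
  have hα : 2 * (-(M / (4 * r)) + N / r ^ 2) ≤ 0 := by
    have e : 2 * (M / (4 * r)) = M / (2 * r) := by field_simp; ring
    linarith
  have hxx : w₂ t' x' ≤ 0 := by
    refine (second_deriv_le_of_isLocalMax_sub (α := -(M / (4 * r)) + N / r ^ 2)
      (β := M + 2 * M * y' / (4 * r) - 2 * (N / r ^ 2) * x₀)
      (γ := -M * y' - M * y' ^ 2 / (4 * r) + N / r ^ 2 * (x₀ ^ 2 + (y' - x₀) ^ 2))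
      (hw₁ t' ht') (hw₂ t' ht' x') ?_).trans hα
    filter_upwards [Ioo_mem_nhds (show x₀ - r < x' by linarith) (show x' < x₀ + r by linarith),
      Ioi_mem_nhds hlt] with z hz hz'
    have hzy : y' ≤ z := le_of_lt hz'
    have : Φ (t', z, y') ≤ Φ (t', x', y') :=
      hmax (show (t', z, y') ∈ S from ⟨⟨ht', ⟨hz.1.le, hz.2.le⟩, hy'⟩, hzy⟩)
    simp only [hΦ, hB] at this
    linear_combination this
  have hyy : -w₂ t' y' ≤ 0 := by
    refine (second_deriv_le_of_isLocalMax_sub (f := fun y => -w t' y)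
      (α := -(M / (4 * r)) + N / r ^ 2)
      (β := -M + 2 * M * x' / (4 * r) - 2 * (N / r ^ 2) * x₀)
      (γ := M * x' - M * x' ^ 2 / (4 * r) + N / r ^ 2 * (x₀ ^ 2 + (x' - x₀) ^ 2))
      (fun z => (hw₁ t' ht' z).neg) (hw₂ t' ht' y').neg ?_).trans hα
    filter_upwards [Ioo_mem_nhds (show x₀ - r < y' by linarith) (show y' < x₀ + r by linarith),
      Iio_mem_nhds hlt] with z hz hz'
    have hzx : z ≤ x' := le_of_lt hz'
    have : Φ (t', x', z) ≤ Φ (t', x', y') :=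
      hmax (show (t', x', z) ∈ S from ⟨⟨ht', hx', ⟨hz.1.le, hz.2.le⟩⟩, hzx⟩)
    simp only [hΦ, hB] at this
    linear_combination this
  set G : ℝ → ℝ := fun τ => 1 / 2 * (a τ x' * w₂ τ x') - 1 / 2 * (a τ y' * w₂ τ y') with hG
  have hc : ∀ z, ContinuousOn (fun τ => 1 / 2 * (a τ z * w₂ τ z)) (Icc t₀ t₁) := fun z =>
    continuousOn_const.mul ((hac z).mul (hw₂c z))
  have hGc : ContinuousOn G (Icc t₀ t₁) := (hc x').sub (hc y')
  have hGt : G t' ≤ 0 := by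
    have h1 := mul_nonpos_of_nonneg_of_nonpos (ha t' ht' x') hxx
    have h2 := mul_nonneg (ha t' ht' y') (neg_nonpos.1 hyy)
    simp only [hG]
    linarith
  have hev : ∀ᶠ τ in 𝓝[Icc t₀ t₁] t', G τ < η / 2 :=
    (hGc t' ht').eventually_lt continuousWithinAt_const (by linarith)
  obtain ⟨δ, hδ, hball⟩ := Metric.mem_nhdsWithin_iff.1 hev
  set s := max t₀ (t' - δ / 2) with hs
  have hst : s < t' := max_lt ht'0 (by linarith)
  have hs₀ : t₀ ≤ s := le_max_left _ _
  have hsδ : t' - δ / 2 ≤ s := le_max_right _ _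
  have hsI : s ∈ Icc t₀ t₁ := ⟨hs₀, hst.le.trans ht'.2⟩
  have hsub : uIcc s t' ⊆ Icc t₀ t₁ := by
    rw [uIcc_of_le hst.le]
    exact Icc_subset_Icc hs₀ ht'.2
  have hint : ∫ τ in s..t', G τ ≤ η / 2 * (t' - s) := by
    have := intervalIntegral.integral_mono_on (μ := volume) hst.le
      (hGc.mono hsub).intervalIntegrable (intervalIntegrable_const (c := η / 2)) (fun τ hτ => by
        refine le_of_lt (hball ⟨?_, ⟨hs₀.trans hτ.1, hτ.2.trans ht'.2⟩⟩)
        rw [Metric.mem_ball, Real.dist_eq, abs_lt]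
        constructor <;> linarith [hτ.1, hτ.2])
    simp only [intervalIntegral.integral_const, smul_eq_mul] at this
    linarith
  have hi : ∀ z, IntervalIntegrable (fun τ => 1 / 2 * (a τ z * w₂ τ z)) volume s t' := fun z =>
    ((hc z).mono hsub).intervalIntegrable
  rw [hG, intervalIntegral.integral_sub (hi x') (hi y')] at hint
  have e1 := (abs_le.1 (heq x' hx' s hsI t' ht' hst.le)).2
  have e2 := (abs_le.1 (heq y' hy' s hsI t' ht' hst.le)).1
  have e3 : Φ (s, x', y') ≤ Φ (t', x', y') :=
    hmax (show (s, x', y') ∈ S from ⟨⟨hsI, hx', hy'⟩, hxy'⟩)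
  simp only [hΦ] at e3
  nlinarith

/-- The du Bois-Reymond lemma: a continuous `F` with continuous weak derivative `H` on `(0, S)` is
a primitive of `H`. -/
lemma sub_eq_integral_of_weak_deriv {F H : ℝ → ℝ} {S : ℝ} (hS : 0 < S)
    (hF : ContinuousOn F (Icc 0 S)) (hH : ContinuousOn H (Icc 0 S))
    (h : ∀ θ : ℝ → ℝ, ContDiff ℝ (⊤ : ℕ∞) θ → HasCompactSupport θ → tsupport θ ⊆ Ioo 0 S →
      ∫ τ in Icc 0 S, (deriv θ τ * F τ + θ τ * H τ) = 0)
    {s t : ℝ} (hs : s ∈ Icc 0 S) (ht : t ∈ Icc 0 S) : F t - F s = ∫ τ in s..t, H τ := by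
  set p : ℝ → ℝ := fun τ => max 0 (min τ S) with hp
  have hpc : Continuous p := by fun_prop
  have hpm : ∀ τ, p τ ∈ Icc 0 S := fun τ => ⟨le_max_left _ _, max_le hS.le (min_le_right _ _)⟩
  have hpe : ∀ τ ∈ Icc 0 S, p τ = τ := fun τ hτ => by
    simp only [hp]
    rw [min_eq_left hτ.2, max_eq_right hτ.1]
  set F' : ℝ → ℝ := fun τ => F (p τ) with hF'
  set H' : ℝ → ℝ := fun τ => H (p τ) with hH'
  have hFc : Continuous F' := hF.comp_continuous hpc hpm
  have hHc : Continuous H' := hH.comp_continuous hpc hpm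
  have main : ∀ ρ : ContDiffBump (0 : ℝ), ∀ t, ρ.rOut < t → t + ρ.rOut < S →
      HasDerivAt (convolution (ρ.normed volume) F' (ContinuousLinearMap.lsmul ℝ ℝ) volume)
        (convolution (ρ.normed volume) H' (ContinuousLinearMap.lsmul ℝ ℝ) volume t) t := by
    intro ρ t ht ht'
    set k := ρ.normed (volume : Measure ℝ) with hk
    have hkd : ContDiff ℝ (⊤ : ℕ∞) k := ρ.contDiff_normed
    have hkc : HasCompactSupport k := ρ.hasCompactSupport_normed
    have hD := hkc.hasDerivAt_convolution_left (ContinuousLinearMap.lsmul ℝ ℝ) (hkd.of_le (by simp))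
      hFc.locallyIntegrable t (μ := volume)
    have hts : tsupport (fun τ => k (t - τ)) ⊆ Icc (t - ρ.rOut) (t + ρ.rOut) := by
      refine closure_minimal (fun τ hτ => ?_) isClosed_Icc
      have h1 : t - τ ∈ Metric.closedBall (0 : ℝ) ρ.rOut := by
        rw [← ρ.tsupport_normed_eq (μ := volume)]
        exact subset_tsupport _ hτ
      rw [mem_closedBall_zero_iff, Real.norm_eq_abs, abs_le] at h1
      constructor <;> linarith [h1.1, h1.2]
    have hts' : tsupport (fun τ => k (t - τ)) ⊆ Ioo 0 S := hts.trans fun τ hτ =>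
      ⟨by linarith [hτ.1], by linarith [hτ.2]⟩
    have hcs : HasCompactSupport (fun τ => k (t - τ)) :=
      isCompact_Icc.of_isClosed_subset (isClosed_tsupport _) hts
    have hθ := h (fun τ => k (t - τ)) (hkd.comp (by fun_prop)) hcs hts'
    have hdk : ∀ τ, deriv (fun τ => k (t - τ)) τ = -deriv k (t - τ) := fun τ => by
      rw [deriv_comp_const_sub]
    have hz : ∀ τ, τ ∉ Ioo 0 S → k (t - τ) = 0 ∧ deriv k (t - τ) = 0 := fun τ hτ => by
      refine ⟨image_eq_zero_of_notMem_tsupport (f := fun τ => k (t - τ)) fun h1 => hτ (hts' h1), ?_⟩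
      rw [← neg_eq_zero, ← hdk]
      exact image_eq_zero_of_notMem_tsupport fun h1 => hτ (hts' (tsupport_deriv_subset h1))
    have hkk : Continuous (deriv k) := hkd.continuous_deriv (by simp)
    have hi1 : Integrable fun τ => deriv k (t - τ) * F' τ := by
      refine Continuous.integrable_of_hasCompactSupport (by fun_prop) ?_
      refine HasCompactSupport.intro (isCompact_Icc (a := 0) (b := S)) fun τ hτ => ?_
      rw [(hz τ fun h1 => hτ (Ioo_subset_Icc_self h1)).2, zero_mul]
    have hi2 : Integrable fun τ => k (t - τ) * H' τ := by
      refine Continuous.integrable_of_hasCompactSupport ?_ ?_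
      · have := hkd.continuous
        fun_prop
      refine HasCompactSupport.intro (isCompact_Icc (a := 0) (b := S)) fun τ hτ => ?_
      rw [(hz τ fun h1 => hτ (Ioo_subset_Icc_self h1)).1, zero_mul]
    have heq : ∫ τ, (k (t - τ) * H' τ - deriv k (t - τ) * F' τ) = 0 := by
      rw [← hθ, ← setIntegral_eq_integral_of_forall_compl_eq_zero (s := Icc 0 S)]
      · refine setIntegral_congr_fun measurableSet_Icc fun τ hτ => ?_
        simp only [hF', hH', hpe τ hτ, hdk]
        ring
      · intro τ hτ
        obtain ⟨h1, h2⟩ := hz τ fun h1 => hτ (Ioo_subset_Icc_self h1)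
        rw [h1, h2]
        ring
    rw [integral_sub hi2 hi1, sub_eq_zero] at heq
    have hce : convolution k H' (ContinuousLinearMap.lsmul ℝ ℝ) volume t =
        convolution (deriv k) F' (ContinuousLinearMap.lsmul ℝ ℝ) volume t := by
      rw [convolution_eq_swap, convolution_eq_swap]
      simpa using heq
    rw [hce]
    exact hD
  have hIoo : ∀ s t, 0 < s → s ≤ t → t < S → F' t - F' s = ∫ τ in s..t, H' τ := by
    intro s t hs hst ht
    refine eq_of_forall_dist_le fun ε hε => ?_
    have hε' : 0 < ε / (2 + S) := by positivity
    obtain ⟨d₁, hd₁, h₁⟩ := Metric.uniformContinuousOn_iff.1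
      (isCompact_Icc.uniformContinuousOn_of_continuous (hFc.continuousOn (s := Icc 0 S))) _ hε'
    obtain ⟨d₂, hd₂, h₂⟩ := Metric.uniformContinuousOn_iff.1
      (isCompact_Icc.uniformContinuousOn_of_continuous (hHc.continuousOn (s := Icc 0 S))) _ hε'
    obtain ⟨d, hd, hd'⟩ : ∃ d, 0 < d ∧ d < min (min d₁ d₂) (min s (S - t)) :=
      exists_between (lt_min (lt_min hd₁ hd₂) (lt_min hs (by linarith)))
    simp only [lt_min_iff] at hd'
    obtain ⟨⟨hdd₁, hdd₂⟩, hds, hdt⟩ := hd'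
    let ρ : ContDiffBump (0 : ℝ) := ⟨d / 2, d, by linarith, by linarith⟩
    have hclose : ∀ {G : ℝ → ℝ}, Continuous G → (∀ x ∈ Icc 0 S, ∀ y ∈ Icc 0 S, dist x y < d →
        dist (G x) (G y) < ε / (2 + S)) → ∀ τ ∈ Icc s t,
        |convolution (ρ.normed volume) G (ContinuousLinearMap.lsmul ℝ ℝ) volume τ - G τ| ≤
          ε / (2 + S) := by
      intro G hG hGd τ hτ
      refine ρ.dist_normed_convolution_le hG.aestronglyMeasurable fun x hx => (hGd x ?_ τ ?_ hx).le
      · rw [Metric.mem_ball, Real.dist_eq, abs_lt] at hx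
        have : ρ.rOut = d := rfl
        exact ⟨by linarith [hτ.1], by linarith [hτ.2]⟩
      · exact ⟨by linarith [hτ.1], by linarith [hτ.2]⟩
    have hcF := hclose hFc fun x hx y hy hxy => h₁ x hx y hy (hxy.trans hdd₁)
    have hcH := hclose hHc fun x hx y hy hxy => h₂ x hx y hy (hxy.trans hdd₂)
    have hconv : Continuous
        (convolution (ρ.normed volume) H' (ContinuousLinearMap.lsmul ℝ ℝ) volume) :=
      ρ.hasCompactSupport_normed.continuous_convolution_left _ ρ.continuous_normed
        hHc.locallyIntegrable
    have hftc := intervalIntegral.integral_eq_sub_of_hasDerivAt (a := s) (b := t)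
      (fun τ hτ => main ρ τ ?_ ?_) (hconv.intervalIntegrable _ _)
    rotate_left
    · rw [uIcc_of_le hst] at hτ
      exact hds.trans_le hτ.1
    · rw [uIcc_of_le hst] at hτ
      have : ρ.rOut = d := rfl
      linarith [hτ.2]
    have hint : |∫ τ in s..t, (convolution (ρ.normed volume) H' (ContinuousLinearMap.lsmul ℝ ℝ)
        volume τ - H' τ)| ≤ ε / (2 + S) * |t - s| := by
      refine intervalIntegral.norm_integral_le_of_norm_le_const (E := ℝ) fun τ hτ => ?_
      rw [uIoc_of_le hst] at hτ
      exact hcH τ ⟨hτ.1.le, hτ.2⟩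
    rw [intervalIntegral.integral_sub (hconv.intervalIntegrable _ _) (hHc.intervalIntegrable _ _),
      hftc, abs_of_nonneg (sub_nonneg.2 hst)] at hint
    have e1 := hcF s ⟨le_rfl, hst⟩
    have e2 := hcF t ⟨hst, le_rfl⟩
    have e3 : ε / (2 + S) * (t - s) ≤ ε / (2 + S) * S :=
      mul_le_mul_of_nonneg_left (by linarith) hε'.le
    have e4 : ε / (2 + S) * 2 + ε / (2 + S) * S = ε := by field_simp
    rw [Real.dist_eq]
    rw [abs_le] at *
    constructor <;> linarith [e1.1, e1.2, e2.1, e2.2, hint.1, hint.2]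
  have hall : EqOn (fun t => F' t - ∫ τ in (S / 2)..t, H' τ) (fun _ => F' (S / 2)) (Icc 0 S) := by
    have hS2 : 0 < S / 2 := by linarith
    refine EqOn.of_subset_closure (s := Ioo 0 S) (fun t ht => ?_) ?_ continuousOn_const
      Ioo_subset_Icc_self (by rw [closure_Ioo hS.ne])
    · rcases le_total (S / 2) t with h1 | h1
      · have := hIoo _ _ hS2 h1 ht.2
        linarith
      · have := hIoo _ _ ht.1 h1 (by linarith)
        rw [intervalIntegral.integral_symm] at this
        linarith
    · exact (hFc.sub (intervalIntegral.continuous_primitive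
        (fun a b => hHc.intervalIntegrable a b) _)).continuousOn
  have hts := hall ht
  have hss := hall hs
  simp only at hts hss
  have hint : ∫ τ in s..t, H τ = ∫ τ in s..t, H' τ := by
    refine intervalIntegral.integral_congr fun τ hτ => ?_
    have hτ' : τ ∈ Icc 0 S := (uIcc_subset_Icc hs ht) hτ
    simp only [hH', hpe τ hτ']
  rw [hint, ← intervalIntegral.integral_interval_sub_left (a := S / 2)
    (hHc.intervalIntegrable _ _) (hHc.intervalIntegrable _ _)]
  simp only [hF', hpe _ ht, hpe _ hs] at hts hss
  linarith

/-- The pairing of `u(t,·)` with `φ`. -/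
def moment (u : ℝ → ℝ → ℝ) (φ : ℝ → ℝ) (t : ℝ) : ℝ := ∫ x, φ x * u t x

/-- The pairing of `∂ₓ(φ u(t,·))` with `∂ₓ u(t,·)`. -/
def flux (u : ℝ → ℝ → ℝ) (φ : ℝ → ℝ) (t : ℝ) : ℝ :=
  ∫ x, (deriv φ x * u t x + φ x * deriv (u t) x) * deriv (u t) x

namespace RegWeak

variable {T : ℝ} {u : ℝ → ℝ → ℝ}

lemma continuous (h : RegWeak T u) {t : ℝ} (ht : t ∈ Ico 0 T) : Continuous (u t) :=
  h.1.comp_continuous (f := fun x => (t, x)) (by fun_prop) fun _ => ⟨ht, mem_univ _⟩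

lemma exists_bound (h : RegWeak T u) {t : ℝ} (ht : t ∈ Ico 0 T) (R : ℝ) :
    ∃ C, 0 ≤ C ∧ ∀ x ∈ Icc (-R) R, |u t x| ≤ C ∧ |deriv (u t) x| ≤ C := by
  obtain ⟨L, hL⟩ := h.2.1 t ht (|R| + 1) (by positivity)
  obtain ⟨U, hU⟩ := (isCompact_Icc (a := -R) (b := R)).exists_bound_of_continuousOn
    (h.continuous ht).continuousOn
  refine ⟨max L U, le_max_of_le_left L.2, fun x hx => ⟨(hU x hx).trans (le_max_right _ _), ?_⟩⟩
  have hR := le_abs_self R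
  exact (norm_deriv_le_of_lipschitzOn (Icc_mem_nhds (by linarith [hx.1]) (by linarith [hx.2]))
    hL).trans (le_max_left _ _)

lemma eventually_close (h : RegWeak T u) {t₀ : ℝ} (ht₀ : t₀ ∈ Ico 0 T) {R : ℝ} (hR : 0 < R)
    {ε : ℝ} (hε : 0 < ε) : ∀ᶠ t in 𝓝[Ico 0 T] t₀, ∀ x ∈ Icc (-R) R,
      |u t x - u t₀ x| < ε ∧ |deriv (u t) x - deriv (u t₀) x| < ε := by
  filter_upwards [(h.2.2 t₀ ht₀ R hR).eventually (gt_mem_nhds hε), self_mem_nhdsWithin] with t h1 ht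
  intro x hx
  obtain ⟨C, -, hC⟩ := h.exists_bound ht R
  obtain ⟨C₀, -, hC₀⟩ := h.exists_bound ht₀ R
  have hb : BddAbove (range fun x : Icc (-R) R =>
      |u t x.1 - u t₀ x.1| + |deriv (u t) x.1 - deriv (u t₀) x.1|) := by
    refine ⟨(C + C₀) + (C + C₀), ?_⟩
    rintro _ ⟨y, rfl⟩
    exact add_le_add
      ((abs_sub _ _).trans (add_le_add (hC y y.2).1 (hC₀ y y.2).1))
      ((abs_sub _ _).trans (add_le_add (hC y y.2).2 (hC₀ y y.2).2))
  have h2 := le_ciSup hb ⟨x, hx⟩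
  simp only at h2
  constructor <;> linarith [abs_nonneg (u t x - u t₀ x), abs_nonneg (deriv (u t) x - deriv (u t₀) x)]

lemma continuousOn_moment (h : RegWeak T u) {φ : ℝ → ℝ} (hφ : Continuous φ)
    (hφc : HasCompactSupport φ) : ContinuousOn (moment u φ) (Ico 0 T) := by
  refine continuousOn_integral_of_compact_support hφc ?_ fun t x _ hx => by
    rw [image_eq_zero_of_notMem_tsupport hx, zero_mul]
  exact (hφ.comp continuous_snd).continuousOn.mul h.1

lemma integrable_flux (h : RegWeak T u) {t : ℝ} (ht : t ∈ Ico 0 T) {φ : ℝ → ℝ}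
    (hφ : ContDiff ℝ (⊤ : ℕ∞) φ) (hφc : HasCompactSupport φ) :
    Integrable fun x => (deriv φ x * u t x + φ x * deriv (u t) x) * deriv (u t) x := by
  obtain ⟨R, hR⟩ := hφc.isBounded.subset_closedBall 0
  rw [Real.closedBall_eq_Icc, zero_sub, zero_add] at hR
  obtain ⟨C, hC0, hC⟩ := h.exists_bound ht R
  have hφ' : Continuous (deriv φ) := hφ.continuous_deriv (by simp)
  have hφ0 := hφ.continuous
  have hu := h.continuous ht
  have hm := measurable_deriv (u t)
  have hbd : Integrable fun x => (|deriv φ x| * C + |φ x| * C) * C := by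
    refine Continuous.integrable_of_hasCompactSupport (by fun_prop) ?_
    refine HasCompactSupport.intro hφc fun x hx => ?_
    rw [image_eq_zero_of_notMem_tsupport hx, image_eq_zero_of_notMem_tsupport
      fun h1 => hx (tsupport_deriv_subset h1)]
    simp
  refine hbd.mono' (by fun_prop) (Eventually.of_forall fun x => ?_)
  by_cases hx : x ∈ tsupport φ
  · obtain ⟨h1, h2⟩ := hC x (hR hx)
    rw [Real.norm_eq_abs, abs_mul]
    gcongr
    refine (abs_add_le _ _).trans ?_
    rw [abs_mul, abs_mul]
    gcongr
  · rw [image_eq_zero_of_notMem_tsupport hx, image_eq_zero_of_notMem_tsupport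
      fun h1 => hx (tsupport_deriv_subset h1)]
    simp

lemma continuousOn_flux (h : RegWeak T u) {φ : ℝ → ℝ}
    (hφ : ContDiff ℝ (⊤ : ℕ∞) φ) (hφc : HasCompactSupport φ) :
    ContinuousOn (flux u φ) (Ico 0 T) := by
  intro t₀ ht₀
  obtain ⟨R, hR0, hR⟩ := hφc.isBounded.subset_closedBall_lt 0 0
  rw [Real.closedBall_eq_Icc, zero_sub, zero_add] at hR
  obtain ⟨C, hC0, hC⟩ := h.exists_bound ht₀ R
  have hφ' : Continuous (deriv φ) := hφ.continuous_deriv (by simp)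
  have hφ0 := hφ.continuous
  have hz : ∀ x, x ∉ tsupport φ → φ x = 0 ∧ deriv φ x = 0 := fun x hx =>
    ⟨image_eq_zero_of_notMem_tsupport hx, image_eq_zero_of_notMem_tsupport
      fun h1 => hx (tsupport_deriv_subset h1)⟩
  refine tendsto_integral_filter_of_dominated_convergence
    (fun x => (|deriv φ x| * (C + 1) + |φ x| * (C + 1)) * (C + 1)) ?_ ?_ ?_ ?_
  · filter_upwards [self_mem_nhdsWithin] with t ht
    exact (h.integrable_flux ht hφ hφc).aestronglyMeasurable
  · filter_upwards [h.eventually_close ht₀ hR0 one_pos] with t ht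
    refine Eventually.of_forall fun x => ?_
    by_cases hx : x ∈ tsupport φ
    · obtain ⟨h1, h2⟩ := hC x (hR hx)
      obtain ⟨h3, h4⟩ := ht x (hR hx)
      have h5 : |u t x| ≤ C + 1 := by
        linarith [abs_sub_abs_le_abs_sub (u t x) (u t₀ x)]
      have h6 : |deriv (u t) x| ≤ C + 1 := by
        linarith [abs_sub_abs_le_abs_sub (deriv (u t) x) (deriv (u t₀) x)]
      rw [Real.norm_eq_abs, abs_mul]
      gcongr
      refine (abs_add_le _ _).trans ?_
      rw [abs_mul, abs_mul]
      gcongr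
    · simp [hz x hx]
  · refine Continuous.integrable_of_hasCompactSupport (by fun_prop) ?_
    refine HasCompactSupport.intro hφc fun x hx => ?_
    simp [hz x hx]
  · refine Eventually.of_forall fun x => ?_
    by_cases hx : x ∈ tsupport φ
    · have h1 : Tendsto (fun t => u t x) (𝓝[Ico 0 T] t₀) (𝓝 (u t₀ x)) := by
        rw [Metric.tendsto_nhds]
        intro ε hε
        filter_upwards [h.eventually_close ht₀ hR0 hε] with t ht
        exact (ht x (hR hx)).1
      have h2 : Tendsto (fun t => deriv (u t) x) (𝓝[Ico 0 T] t₀) (𝓝 (deriv (u t₀) x)) := by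
        rw [Metric.tendsto_nhds]
        intro ε hε
        filter_upwards [h.eventually_close ht₀ hR0 hε] with t ht
        exact (ht x (hR hx)).2
      exact ((h1.const_mul _).add (h2.const_mul _)).mul h2
    · simp [hz x hx, tendsto_const_nhds]

end RegWeak

lemma IsWeakSolution.moment_sub {T : ℝ} {u : ℝ → ℝ → ℝ} (hu : IsWeakSolution T u) {S : ℝ}
    (hS : 0 < S) (hST : S < T)
    (hd : ∀ᵐ t ∂(volume.restrict (Ioc 0 S)), Differentiable ℝ (u t))
    {φ : ℝ → ℝ} (hφ : ContDiff ℝ (⊤ : ℕ∞) φ) (hφc : HasCompactSupport φ) {s t : ℝ}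
    (hs : s ∈ Icc 0 S) (ht : t ∈ Icc 0 S) :
    moment u φ t - moment u φ s = ∫ τ in s..t, -(1 / 2) * flux u φ τ := by
  obtain ⟨-, hreg, hw⟩ := hu
  have hsub : Icc 0 S ⊆ Ico 0 T := fun x hx => ⟨hx.1, hx.2.trans_lt hST⟩
  refine sub_eq_integral_of_weak_deriv (H := fun τ => -(1 / 2) * flux u φ τ) hS
    ((hreg.continuousOn_moment hφ.continuous hφc).mono hsub)
    (continuousOn_const.mul ((hreg.continuousOn_flux hφ hφc).mono hsub)) ?_ hs ht
  intro θ hθ hθc hθs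
  have hz : ∀ τ, τ ∉ Ioo 0 S → θ τ = 0 ∧ deriv θ τ = 0 := fun τ hτ =>
    ⟨image_eq_zero_of_notMem_tsupport fun h1 => hτ (hθs h1), image_eq_zero_of_notMem_tsupport
      fun h1 => hτ (hθs (tsupport_deriv_subset h1))⟩
  have key := hw (fun τ x => θ τ * φ x) ?_ ?_ ?_
  rotate_left
  · exact (hθ.comp contDiff_fst).mul (hφ.comp contDiff_snd)
  · refine HasCompactSupport.intro (hθc.isCompact.prod hφc.isCompact) fun p hp => ?_
    rw [mem_prod, not_and_or] at hp
    rcases hp with hp | hp <;> simp [uncurry, image_eq_zero_of_notMem_tsupport hp]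
  · refine (closure_minimal (t := tsupport θ ×ˢ univ) (fun p hp => ⟨?_, mem_univ _⟩)
      ((isClosed_tsupport _).prod isClosed_univ)).trans
      (prod_mono (fun x hx => (hθs hx).2.trans hST) subset_rfl)
    by_contra hp'
    exact hp (by simp [uncurry, image_eq_zero_of_notMem_tsupport hp'])
  simp only [(hz 0 (by simp)).1, zero_mul, mul_zero, integral_zero, zero_add] at key
  set f : ℝ → ℝ := fun τ => ∫ x, (u τ x * deriv (fun s => θ s * φ x) τ
    - 1 / 2 * deriv (fun y => θ τ * φ y * u τ y) x * deriv (u τ) x) with hf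
  have hf0 : ∀ τ, τ ∉ Ioo 0 S → f τ = 0 := by
    intro τ hτ
    simp only [hf, deriv_mul_const_field, (hz τ hτ).1, (hz τ hτ).2]
    simp
  have e1 : ∫ τ in Ico 0 T, f τ = ∫ τ in Icc 0 S, f τ := by
    rw [setIntegral_eq_integral_of_forall_compl_eq_zero,
      setIntegral_eq_integral_of_forall_compl_eq_zero]
    · exact fun x hx => hf0 x fun h1 => hx (Ioo_subset_Icc_self h1)
    · exact fun x hx => hf0 x fun h1 => hx (hsub (Ioo_subset_Icc_self h1))
  refine Eq.trans ?_ key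
  rw [e1, integral_Icc_eq_integral_Ioc, integral_Icc_eq_integral_Ioc]
  refine integral_congr_ae ?_
  filter_upwards [hd, ae_restrict_mem measurableSet_Ioc] with τ hτ hτm
  have hτT : τ ∈ Ico 0 T := hsub (Ioc_subset_Icc_self hτm)
  have hφd := hφ.differentiable (by simp)
  have hder : ∀ x, deriv (fun y => θ τ * φ y * u τ y) x =
      θ τ * (deriv φ x * u τ x + φ x * deriv (u τ) x) := by
    intro x
    have := ((hφd x).hasDerivAt.const_mul (θ τ)).mul (hτ x).hasDerivAt
    refine (HasDerivAt.deriv this).trans ?_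
    ring
  have hi : Integrable fun x => φ x * u τ x :=
    (hφ.continuous.mul (hreg.continuous hτT)).integrable_of_hasCompactSupport hφc.mul_right
  simp only [hf, hder, deriv_mul_const_field]
  have e2 : ∀ x, u τ x * (deriv θ τ * φ x) -
      1 / 2 * (θ τ * (deriv φ x * u τ x + φ x * deriv (u τ) x)) * deriv (u τ) x =
      deriv θ τ * (φ x * u τ x) - (1 / 2 * θ τ) *
        ((deriv φ x * u τ x + φ x * deriv (u τ) x) * deriv (u τ) x) := fun x => by ring
  simp only [e2]
  rw [integral_sub (hi.const_mul _) ((hreg.integrable_flux hτT hφ hφc).const_mul _),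
    integral_const_mul, integral_const_mul]
  simp only [moment, flux]
  ring

lemma flux_eq {u : ℝ → ℝ → ℝ} {t c : ℝ} (h1 : Differentiable ℝ (u t))
    (h2 : Differentiable ℝ (deriv (u t))) (hc : ∀ x, |deriv (deriv (u t)) x| ≤ c)
    {φ : ℝ → ℝ} (hφ : ContDiff ℝ (⊤ : ℕ∞) φ) (hφc : HasCompactSupport φ) :
    flux u φ t = -∫ x, φ x * u t x * deriv (deriv (u t)) x := by
  have hφd := hφ.differentiable (by simp)
  have hφ' : Continuous (deriv φ) := hφ.continuous_deriv (by simp)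
  have hφ0 := hφ.continuous
  have hu0 := h1.continuous
  have hu1 := h2.continuous
  rw [integral_mul_deriv_eq_deriv_mul_of_integrable
    (u := fun x => φ x * u t x) (u' := fun x => deriv φ x * u t x + φ x * deriv (u t) x)
    (v := deriv (u t)) (fun x _ => (hφd x).hasDerivAt.mul (h1 x).hasDerivAt)
    (fun x _ => (h2 x).hasDerivAt), neg_neg, flux]
  · refine Integrable.mul_bdd (c := c) ?_ (measurable_deriv _).aestronglyMeasurable
      (Eventually.of_forall hc)
    exact (hφ0.mul hu0).integrable_of_hasCompactSupport hφc.mul_right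
  · refine Continuous.integrable_of_hasCompactSupport (by fun_prop) ?_
    exact ((hφc.deriv.mul_right).add hφc.mul_right).mul_right
  · refine Continuous.integrable_of_hasCompactSupport (by fun_prop) ?_
    exact (hφc.mul_right).mul_right

/-- A two-sided Grönwall inequality with an integrable rate. -/
lemma le_exp_mul_of_abs_deriv_le {F H g : ℝ → ℝ} {S : ℝ}
    (hF : ContinuousOn F (Icc 0 S)) (hH : ContinuousOn H (Icc 0 S)) (hF0 : ∀ t ∈ Icc 0 S, 0 ≤ F t)
    (hFH : ∀ s ∈ Icc 0 S, ∀ t ∈ Icc 0 S, F t - F s = ∫ τ in s..t, H τ)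
    (hg : IntegrableOn g (Ioc 0 S)) (hg0 : 0 ≤ᵐ[volume.restrict (Ioc 0 S)] g)
    (hHg : ∀ᵐ τ ∂(volume.restrict (Ioc 0 S)), |H τ| ≤ g τ * F τ)
    {s t : ℝ} (hs : s ∈ Icc 0 S) (ht : t ∈ Icc 0 S) :
    F t ≤ Real.exp (∫ τ in Ioc 0 S, g τ) * F s := by
  set G := ∫ τ in Ioc 0 S, g τ with hG
  have key : ∀ δ > 0, ∀ s ∈ Icc 0 S, ∀ t ∈ Icc 0 S, s ≤ t →
      |Real.log (F t + δ) - Real.log (F s + δ)| ≤ G := by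
    intro δ hδ s hs t ht hst
    have hsub : Icc s t ⊆ Icc 0 S := Icc_subset_Icc hs.1 ht.2
    have hpos : ∀ τ ∈ Icc 0 S, 0 < F τ + δ := fun τ hτ => by linarith [hF0 τ hτ]
    have hd : ∀ τ ∈ Ioo s t, HasDerivAt (fun τ => Real.log (F τ + δ)) (H τ / (F τ + δ)) τ := by
      intro τ hτ
      have hτ0 : Ioo 0 S ∈ 𝓝 τ := Ioo_mem_nhds (hs.1.trans_lt hτ.1) (hτ.2.trans_le ht.2)
      have hτm := hsub (Ioo_subset_Icc_self hτ)
      have h1 : HasDerivAt (fun b => ∫ τ in s..b, H τ) (H τ) τ := by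
        refine intervalIntegral.integral_hasDerivAt_right
          ((hH.mono (uIcc_subset_Icc hs hτm)).intervalIntegrable)
          ((hH.mono Ioo_subset_Icc_self).stronglyMeasurableAtFilter isOpen_Ioo τ
            (mem_of_mem_nhds hτ0)) ((hH.mono Ioo_subset_Icc_self).continuousAt hτ0)
      have h2 : HasDerivAt F (H τ) τ := by
        refine (h1.add_const (F s)).congr_of_eventuallyEq ?_
        filter_upwards [hτ0] with b hb
        linarith [hFH s hs b (Ioo_subset_Icc_self hb)]
      exact (h2.add_const δ).log (hpos τ hτm).ne'
    have hc : ContinuousOn (fun τ => H τ / (F τ + δ)) (Icc 0 S) :=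
      hH.div (hF.add continuousOn_const) fun τ hτ => (hpos τ hτ).ne'
    rw [← intervalIntegral.integral_eq_sub_of_hasDerivAt_of_le
      (f := fun τ => Real.log (F τ + δ)) hst
      (((hF.mono hsub).add continuousOn_const).log fun τ hτ => (hpos τ (hsub hτ)).ne') hd
      ((hc.mono (uIcc_subset_Icc hs ht)).intervalIntegrable)]
    have hsub' : Ioc s t ⊆ Ioc 0 S := Ioc_subset_Ioc hs.1 ht.2
    rw [intervalIntegral.integral_of_le hst]
    refine (norm_integral_le_of_norm_le (f := fun τ => H τ / (F τ + δ)) (hg.mono_set hsub') ?_).trans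
      (setIntegral_mono_set hg hg0 hsub'.eventuallyLE)
    filter_upwards [ae_restrict_of_ae_restrict_of_subset hsub' hHg,
      ae_restrict_of_ae_restrict_of_subset hsub' hg0,
      ae_restrict_mem measurableSet_Ioc] with τ h1 h2 h3
    have h4 := hpos τ (Ioc_subset_Icc_self (hsub' h3))
    rw [Real.norm_eq_abs, abs_div, abs_of_pos h4, div_le_iff₀ h4]
    refine h1.trans (mul_le_mul_of_nonneg_left (by linarith) h2)
  have key' : ∀ δ > 0, F t + δ ≤ Real.exp G * (F s + δ) := by
    intro δ hδ
    have h1 : Real.log (F t + δ) - Real.log (F s + δ) ≤ G := by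
      rcases le_total s t with hst | hst
      · exact (le_abs_self _).trans (key δ hδ s hs t ht hst)
      · rw [← neg_sub]
        exact (neg_le_abs _).trans (key δ hδ t ht s hs hst)
    have ht0 : 0 < F t + δ := by linarith [hF0 t ht]
    have hs0 : 0 < F s + δ := by linarith [hF0 s hs]
    rw [← Real.log_le_log_iff ht0 (by positivity), Real.log_mul (Real.exp_pos G).ne' hs0.ne',
      Real.log_exp]
    linarith
  refine le_of_forall_pos_le_add fun ε hε => ?_
  have hE := Real.exp_pos G
  have h1 := key' (ε / Real.exp G) (by positivity)
  have h2 : Real.exp G * (ε / Real.exp G) = ε := by field_simp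
  have h3 : 0 < ε / Real.exp G := by positivity
  rw [mul_add, h2] at h1
  linarith

/-- A weak solution on `[0,T)` together with an integrable bound `g` for the second spatial
derivative on `[0,S]`. -/
structure HasSecondDerivBound (T S : ℝ) (u : ℝ → ℝ → ℝ) (g : ℝ → ℝ) : Prop where
  weak : IsWeakSolution T u
  pos : 0 < S
  lt : S < T
  integrable : IntegrableOn g (Ioc 0 S)
  differentiable : ∀ᵐ t ∂(volume.restrict (Ioc 0 S)), Differentiable ℝ (u t)
  differentiable_deriv : ∀ᵐ t ∂(volume.restrict (Ioc 0 S)), Differentiable ℝ (deriv (u t))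
  bound : ∀ᵐ t ∂(volume.restrict (Ioc 0 S)), ∀ x, |deriv (deriv (u t)) x| ≤ g t

namespace HasSecondDerivBound

variable {T S : ℝ} {u : ℝ → ℝ → ℝ} {g : ℝ → ℝ}

lemma Icc_subset (h : HasSecondDerivBound T S u g) : Icc 0 S ⊆ Ico 0 T :=
  fun _ hx => ⟨hx.1, hx.2.trans_lt h.lt⟩

lemma nonneg_bound (h : HasSecondDerivBound T S u g) : 0 ≤ᵐ[volume.restrict (Ioc 0 S)] g := by
  filter_upwards [h.bound] with t ht
  exact (abs_nonneg _).trans (ht 0)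

lemma moment_sub (h : HasSecondDerivBound T S u g) {φ : ℝ → ℝ} (hφ : ContDiff ℝ (⊤ : ℕ∞) φ)
    (hφc : HasCompactSupport φ) {s t : ℝ} (hs : s ∈ Icc 0 S) (ht : t ∈ Icc 0 S) :
    moment u φ t - moment u φ s = ∫ τ in s..t, -(1 / 2) * flux u φ τ :=
  h.weak.moment_sub h.pos h.lt h.differentiable hφ hφc hs ht

/-- Values of the solution at the same point and different times are comparable. -/
lemma le_exp_mul (h : HasSecondDerivBound T S u g) {s t : ℝ} (hs : s ∈ Icc 0 S)
    (ht : t ∈ Icc 0 S) (x : ℝ) :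
    u t x ≤ Real.exp (∫ τ in Ioc 0 S, 1 / 2 * g τ) * u s x := by
  have hreg := h.weak.2.1
  have hu0 := h.weak.1
  set C := Real.exp (∫ τ in Ioc 0 S, 1 / 2 * g τ)
  have hm : ∀ φ : ℝ → ℝ, ContDiff ℝ (⊤ : ℕ∞) φ → HasCompactSupport φ → (∀ x, 0 ≤ φ x) →
      moment u φ t ≤ C * moment u φ s := by
    intro φ hφ hφc hφ0
    refine le_exp_mul_of_abs_deriv_le (H := fun τ => -(1 / 2) * flux u φ τ)
      ((hreg.continuousOn_moment hφ.continuous hφc).mono h.Icc_subset)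
      (continuousOn_const.mul ((hreg.continuousOn_flux hφ hφc).mono h.Icc_subset))
      (fun τ hτ => integral_nonneg fun x => mul_nonneg (hφ0 x) (hu0 τ (h.Icc_subset hτ) x))
      (fun s hs t ht => h.moment_sub hφ hφc hs ht) (h.integrable.const_mul _) ?_ ?_ hs ht
    · filter_upwards [h.nonneg_bound] with τ hτ
      exact mul_nonneg (by norm_num) hτ
    · filter_upwards [h.differentiable, h.differentiable_deriv, h.bound,
        ae_restrict_mem measurableSet_Ioc] with τ h1 h2 h3 h4
      have hτ := h.Icc_subset (Ioc_subset_Icc_self h4)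
      have hi : Integrable fun x => φ x * u τ x :=
        (hφ.continuous.mul (hreg.continuous hτ)).integrable_of_hasCompactSupport hφc.mul_right
      have h5 : |∫ x, φ x * u τ x * deriv (deriv (u τ)) x| ≤ ∫ x, g τ * (φ x * u τ x) := by
        refine norm_integral_le_of_norm_le (f := fun x => φ x * u τ x * deriv (deriv (u τ)) x)
          (hi.const_mul _) (Eventually.of_forall fun x => ?_)
        have h6 := mul_nonneg (hφ0 x) (hu0 τ hτ x)
        rw [Real.norm_eq_abs, abs_mul, abs_of_nonneg h6, mul_comm]
        exact mul_le_mul_of_nonneg_right (h3 x) h6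
      rw [integral_const_mul] at h5
      rw [flux_eq h1 h2 h3 hφ hφc, neg_mul_neg, abs_mul, abs_of_pos (by norm_num), mul_assoc]
      exact mul_le_mul_of_nonneg_left h5 (by norm_num)
  have hct := hreg.continuous (h.Icc_subset ht)
  have hcs := hreg.continuous (h.Icc_subset hs)
  by_contra! hlt
  have hev : ∀ᶠ y in 𝓝 x, C * u s y < u t y :=
    (hcs.const_mul C).continuousAt.eventually_lt hct.continuousAt hlt
  obtain ⟨d, hd, hball⟩ := Metric.eventually_nhds_iff_ball.1 hev
  let ρ : ContDiffBump x := ⟨d / 2, d, by linarith, by linarith⟩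
  have hit : Integrable fun y => ρ y * u t y :=
    (ρ.continuous.mul hct).integrable_of_hasCompactSupport ρ.hasCompactSupport.mul_right
  have his : Integrable fun y => ρ y * u s y :=
    (ρ.continuous.mul hcs).integrable_of_hasCompactSupport ρ.hasCompactSupport.mul_right
  have hpos : 0 < ∫ y, ρ y * (u t y - C * u s y) := by
    refine Continuous.integral_pos_of_hasCompactSupport_nonneg_nonzero (x := x)
      (ρ.continuous.mul (hct.sub (hcs.const_mul C))) ρ.hasCompactSupport.mul_right (fun y => ?_) ?_
    · by_cases hy : y ∈ Metric.ball x d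
      · exact mul_nonneg ρ.nonneg (sub_nonneg.2 (hball y hy).le)
      · rw [ρ.zero_of_le_dist (not_lt.1 hy)]
        simp
    · have h1 : ρ x = 1 := ρ.one_of_mem_closedBall (Metric.mem_closedBall_self ρ.rIn_pos.le)
      rw [h1, one_mul]
      exact (sub_pos.2 hlt).ne'
  have h1 := hm ρ ρ.contDiff ρ.hasCompactSupport fun _ => ρ.nonneg
  have h2 : ∫ y, ρ y * (u t y - C * u s y) = moment u ρ t - C * moment u ρ s := by
    rw [moment, moment, ← integral_const_mul, ← integral_sub hit (his.const_mul _)]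
    congr 1
    ext y
    ring
  linarith

end HasSecondDerivBound

/-- Two-sided version of `sub_le_of_approx_heat`. -/
lemma abs_sub_le_of_approx_heat {w w₁ w₂ a : ℝ → ℝ → ℝ} {h : ℝ → ℝ} {t₀ t₁ x₀ r N L₀ M : ℝ}
    (hr : 0 < r) (hN : 0 ≤ N) (hM : 2 * L₀ ≤ M) (hM' : 4 * N / r ≤ M)
    (hw : ContinuousOn (uncurry w) (Icc t₀ t₁ ×ˢ univ))
    (hw₁ : ∀ t ∈ Icc t₀ t₁, ∀ x, HasDerivAt (w t) (w₁ t x) x)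
    (hw₂ : ∀ t ∈ Icc t₀ t₁, ∀ x, HasDerivAt (w₁ t) (w₂ t x) x)
    (hw₂c : ∀ x, ContinuousOn (fun t => w₂ t x) (Icc t₀ t₁))
    (hac : ∀ x, ContinuousOn (fun t => a t x) (Icc t₀ t₁))
    (ha : ∀ t ∈ Icc t₀ t₁, ∀ x, 0 ≤ a t x)
    (hh : ContinuousOn h (Icc t₀ t₁))
    (heq : ∀ x ∈ Icc (x₀ - r) (x₀ + r), ∀ s ∈ Icc t₀ t₁, ∀ t ∈ Icc t₀ t₁, s ≤ t →
      |w t x - w s x - ∫ τ in s..t, 1 / 2 * (a τ x * w₂ τ x)| ≤ h t - h s)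
    (hosc : ∀ t ∈ Icc t₀ t₁, ∀ x ∈ Icc (x₀ - r) (x₀ + r), ∀ y ∈ Icc (x₀ - r) (x₀ + r),
      w t x - w t y ≤ N)
    (hinit : ∀ x ∈ Icc (x₀ - r) (x₀ + r), ∀ y ∈ Icc (x₀ - r) (x₀ + r),
      |w t₀ x - w t₀ y| ≤ L₀ * |x - y|)
    {t x y : ℝ} (ht : t ∈ Icc t₀ t₁) (hx : x ∈ Icc (x₀ - r) (x₀ + r))
    (hy : y ∈ Icc (x₀ - r) (x₀ + r)) :
    |w t x - w t y| ≤ M * |x - y| + N / r ^ 2 * ((x - x₀) ^ 2 + (y - x₀) ^ 2)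
      + 2 * (h t - h t₀) := by
  wlog hxy : y ≤ x generalizing x y
  · rw [abs_sub_comm, abs_sub_comm x, add_comm ((x - x₀) ^ 2)]
    exact this hy hx (not_le.1 hxy).le
  rw [abs_of_nonneg (sub_nonneg.2 hxy), abs_le']
  constructor
  · refine sub_le_of_approx_heat hr hN hM hM' hw hw₁ hw₂ hw₂c hac ha hh heq hosc ?_ ht hx hy hxy
    intro x hx y hy hxy
    have := hinit x hx y hy
    rw [abs_of_nonneg (sub_nonneg.2 hxy)] at this
    exact (le_abs_self _).trans this
  · have := sub_le_of_approx_heat (w := fun t x => -w t x) (w₁ := fun t x => -w₁ t x)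
      (w₂ := fun t x => -w₂ t x) (a := a) (h := h) (t₀ := t₀) (t₁ := t₁) (x₀ := x₀) (L₀ := L₀)
      hr hN hM hM' hw.neg (fun t ht x => (hw₁ t ht x).neg)
      (fun t ht x => (hw₂ t ht x).neg) (fun x => (hw₂c x).neg) hac ha hh ?_ ?_ ?_ ht hx hy hxy
    · linarith
    · intro x hx s hs t ht hst
      refine le_of_eq_of_le ?_ (heq x hx s hs t ht hst)
      rw [← abs_neg]
      congr 1
      simp only [mul_neg, intervalIntegral.integral_neg]
      ring
    · intro t ht x hx y hy
      linarith [hosc t ht y hy x hx]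
    · intro x hx y hy hxy
      have := hinit x hx y hy
      rw [abs_of_nonneg (sub_nonneg.2 hxy)] at this
      linarith [neg_abs_le (w t₀ x - w t₀ y)]

/-- Convolution of a kernel with `u(t,·)`. -/
def mollify (k : ℝ → ℝ) (u : ℝ → ℝ → ℝ) (t x : ℝ) : ℝ :=
  convolution k (u t) (ContinuousLinearMap.lsmul ℝ ℝ) volume x

lemma mollify_eq_moment (k : ℝ → ℝ) (u : ℝ → ℝ → ℝ) (t x : ℝ) :
    mollify k u t x = moment u (fun y => k (x - y)) t := by
  rw [mollify, convolution_eq_swap]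
  simp [moment]

lemma hasDerivAt_mollify {k : ℝ → ℝ} (hk : ContDiff ℝ (⊤ : ℕ∞) k) (hkc : HasCompactSupport k)
    {u : ℝ → ℝ → ℝ} {t : ℝ} (hu : Continuous (u t)) (x : ℝ) :
    HasDerivAt (mollify k u t) (mollify (deriv k) u t x) x :=
  hkc.hasDerivAt_convolution_left (ContinuousLinearMap.lsmul ℝ ℝ) (hk.of_le (by simp))
    hu.locallyIntegrable x (μ := volume)

lemma continuousOn_mollify {k : ℝ → ℝ} (hk : Continuous k) (hkc : HasCompactSupport k)
    {u : ℝ → ℝ → ℝ} {s : Set ℝ} (hu : ContinuousOn (uncurry u) (s ×ˢ univ)) :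
    ContinuousOn (uncurry (mollify k u)) (s ×ˢ univ) := by
  have h : ContinuousOn (fun p : ℝ × ℝ => ∫ y, k y * u p.1 (p.2 - y)) (s ×ˢ univ) := by
    refine continuousOn_integral_of_compact_support hkc ?_ fun p x _ hx => by
      rw [image_eq_zero_of_notMem_tsupport hx, zero_mul]
    refine (hk.comp continuous_snd).continuousOn.mul ?_
    refine hu.comp (f := fun q : (ℝ × ℝ) × ℝ => (q.1.1, q.1.2 - q.2)) (by fun_prop) ?_
    exact fun q hq => ⟨hq.1.1, mem_univ _⟩
  exact h

lemma mollify_deriv_deriv {k : ℝ → ℝ} (hk : ContDiff ℝ (⊤ : ℕ∞) k) (hkc : HasCompactSupport k)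
    {u : ℝ → ℝ → ℝ} {t c : ℝ} (h1 : Differentiable ℝ (u t)) (h2 : Differentiable ℝ (deriv (u t)))
    (hc : ∀ x, |deriv (deriv (u t)) x| ≤ c) (x : ℝ) :
    mollify (deriv (deriv k)) u t x = ∫ y, k (x - y) * deriv (deriv (u t)) y := by
  have hk' : ContDiff ℝ (⊤ : ℕ∞) (deriv k) := hk.deriv'
  have hk'' : ContDiff ℝ (⊤ : ℕ∞) (deriv (deriv k)) := hk'.deriv'
  have hk0 := hk.continuous
  have hk1 := hk'.continuous
  have hk2 := hk''.continuous
  have hu0 := h1.continuous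
  have hu1 := h2.continuous
  have hcs : ∀ {f : ℝ → ℝ}, HasCompactSupport f → HasCompactSupport fun y => f (x - y) :=
    fun hf => hf.comp_homeomorph (Homeomorph.subLeft x)
  have hd : ∀ {f : ℝ → ℝ}, Differentiable ℝ f → ∀ y,
      HasDerivAt (fun y => f (x - y)) (-deriv f (x - y)) y := fun hf y => by
    simpa using (hf (x - y)).hasDerivAt.comp_const_sub x y
  have e1 := integral_mul_deriv_eq_deriv_mul_of_integrable (u := u t) (u' := deriv (u t))
    (v := fun y => deriv k (x - y)) (v' := fun y => -deriv (deriv k) (x - y))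
    (fun y _ => (h1 y).hasDerivAt) (fun y _ => hd (hk'.differentiable (by simp)) y)
    (Continuous.integrable_of_hasCompactSupport (by fun_prop)
      ((hcs hkc.deriv.deriv).neg.mul_left))
    (Continuous.integrable_of_hasCompactSupport (by fun_prop) ((hcs hkc.deriv).mul_left))
    (Continuous.integrable_of_hasCompactSupport (by fun_prop) ((hcs hkc.deriv).mul_left))
  have e2 := integral_mul_deriv_eq_deriv_mul_of_integrable (u := deriv (u t))
    (u' := deriv (deriv (u t))) (v := fun y => k (x - y)) (v' := fun y => -deriv k (x - y))
    (fun y _ => (h2 y).hasDerivAt) (fun y _ => hd (hk.differentiable (by simp)) y)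
    (Continuous.integrable_of_hasCompactSupport (by fun_prop) ((hcs hkc.deriv).neg.mul_left))
    (Integrable.bdd_mul (c := c) (Continuous.integrable_of_hasCompactSupport (by fun_prop)
      (hcs hkc)) (measurable_deriv _).aestronglyMeasurable (Eventually.of_forall hc))
    (Continuous.integrable_of_hasCompactSupport (by fun_prop) ((hcs hkc).mul_left))
  simp only [mul_neg, integral_neg] at e1 e2
  rw [mollify_eq_moment, moment]
  simp only [mul_comm (deriv (deriv k) _), mul_comm (k _)]
  linarith

namespace HasSecondDerivBound

variable {T S : ℝ} {u : ℝ → ℝ → ℝ} {g : ℝ → ℝ}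

/-- The mollified solution almost solves the equation, with an error controlled by the local
oscillation of the solution. -/
lemma abs_mollify_sub_le (h : HasSecondDerivBound T S u g) (ρ : ContDiffBump (0 : ℝ)) {x ω s t : ℝ}
    (hs : s ∈ Icc 0 S) (ht : t ∈ Icc 0 S) (hst : s ≤ t)
    (hω : ∀ τ ∈ Icc 0 S, ∀ y, |y - x| < ρ.rOut → |u τ y - u τ x| ≤ ω) :
    |mollify (ρ.normed volume) u t x - mollify (ρ.normed volume) u s x -
      ∫ τ in s..t, 1 / 2 * (u τ x * mollify (deriv (deriv (ρ.normed volume))) u τ x)| ≤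
        ∫ τ in s..t, 1 / 2 * ω * g τ := by
  have hreg := h.weak.2.1
  set k := ρ.normed (volume : Measure ℝ) with hk
  have hkd : ContDiff ℝ (⊤ : ℕ∞) k := ρ.contDiff_normed
  have hkc : HasCompactSupport k := ρ.hasCompactSupport_normed
  have hk1 : ContDiff ℝ (⊤ : ℕ∞) (deriv k) := hkd.deriv'
  have hk2 : ContDiff ℝ (⊤ : ℕ∞) (deriv (deriv k)) := hk1.deriv'
  have hφ : ContDiff ℝ (⊤ : ℕ∞) fun y => k (x - y) := hkd.comp (by fun_prop)
  have hφc : HasCompactSupport fun y => k (x - y) := hkc.comp_homeomorph (Homeomorph.subLeft x)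
  have hsub : uIcc s t ⊆ Icc 0 S := uIcc_subset_Icc hs ht
  have hI1 : IntervalIntegrable (fun τ => -(1 / 2) * flux u (fun y => k (x - y)) τ) volume s t :=
    (continuousOn_const.mul
      ((hreg.continuousOn_flux hφ hφc).mono (hsub.trans h.Icc_subset))).intervalIntegrable
  have hI2 : IntervalIntegrable (fun τ => 1 / 2 * (u τ x * mollify (deriv (deriv k)) u τ x))
      volume s t := by
    have hux : ContinuousOn (fun τ => u τ x) (uIcc s t) :=
      hreg.1.comp (f := fun τ => (τ, x)) (by fun_prop)
        fun τ hτ => ⟨h.Icc_subset (hsub hτ), mem_univ _⟩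
    have hmx : ContinuousOn (fun τ => mollify (deriv (deriv k)) u τ x) (uIcc s t) :=
      (continuousOn_mollify hk2.continuous hkc.deriv.deriv hreg.1).comp
        (f := fun τ => (τ, x)) (by fun_prop) fun τ hτ => ⟨h.Icc_subset (hsub hτ), mem_univ _⟩
    exact (continuousOn_const.mul (hux.mul hmx)).intervalIntegrable
  rw [mollify_eq_moment, mollify_eq_moment, h.moment_sub hφ hφc hs ht,
    ← intervalIntegral.integral_sub hI1 hI2]
  have hsub' : Ioc s t ⊆ Ioc 0 S := Ioc_subset_Ioc hs.1 ht.2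
  refine intervalIntegral.norm_integral_le_of_norm_le (E := ℝ) hst ?_ ?_
  · rw [← ae_restrict_iff' measurableSet_Ioc]
    refine ae_restrict_of_ae_restrict_of_subset hsub' ?_
    filter_upwards [h.differentiable, h.differentiable_deriv, h.bound,
      ae_restrict_mem measurableSet_Ioc] with τ h1 h2 h3 h4
    have hτ := Ioc_subset_Icc_self h4
    have hu0 := h1.continuous
    have hk0 := hkd.continuous
    have hm := measurable_deriv (deriv (u τ))
    have hi1 : Integrable fun y => k (x - y) * u τ y * deriv (deriv (u τ)) y :=
      Integrable.mul_bdd (c := g τ) (Continuous.integrable_of_hasCompactSupport (by fun_prop)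
        hφc.mul_right) hm.aestronglyMeasurable (Eventually.of_forall h3)
    have hi2 : Integrable fun y => k (x - y) * deriv (deriv (u τ)) y :=
      Integrable.mul_bdd (c := g τ) (Continuous.integrable_of_hasCompactSupport (by fun_prop)
        hφc) hm.aestronglyMeasurable (Eventually.of_forall h3)
    have hi3 : Integrable fun y => k (x - y) :=
      Continuous.integrable_of_hasCompactSupport (by fun_prop) hφc
    have hk1 : ∫ y, k (x - y) = 1 := by
      rw [integral_sub_left_eq_self k volume x]
      exact ρ.integral_normed
    have e1 : -(1 / 2) * flux u (fun y => k (x - y)) τ -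
        1 / 2 * (u τ x * mollify (deriv (deriv k)) u τ x) =
        1 / 2 * ∫ y, k (x - y) * ((u τ y - u τ x) * deriv (deriv (u τ)) y) := by
      rw [flux_eq h1 h2 h3 hφ hφc, mollify_deriv_deriv hkd hkc h1 h2 h3, ← integral_const_mul,
        neg_mul_neg, ← mul_sub, ← integral_sub hi1 (hi2.const_mul _)]
      congr 2
      ext y
      ring
    have e2 : |∫ y, k (x - y) * ((u τ y - u τ x) * deriv (deriv (u τ)) y)| ≤
        ∫ y, k (x - y) * (ω * g τ) := by
      refine norm_integral_le_of_norm_le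
        (f := fun y => k (x - y) * ((u τ y - u τ x) * deriv (deriv (u τ)) y))
        (hi3.mul_const _) (Eventually.of_forall fun y => ?_)
      rw [Real.norm_eq_abs, abs_mul, abs_mul, abs_of_nonneg (ρ.nonneg_normed _)]
      by_cases hy : |y - x| < ρ.rOut
      · have h5 := hω τ hτ y hy
        have h6 := h3 y
        have h7 := (abs_nonneg _).trans h5
        gcongr
        exact ρ.nonneg_normed _
      · have h5 : k (x - y) = 0 := by
          have h6 : x - y ∉ support k := by
            rw [hk, ρ.support_normed_eq, mem_ball_zero_iff, Real.norm_eq_abs, abs_sub_comm]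
            exact hy
          simpa using h6
        rw [← hk, h5]
        simp
    rw [integral_mul_const, hk1, one_mul] at e2
    rw [e1, Real.norm_eq_abs, abs_mul, abs_of_pos (by norm_num : (0 : ℝ) < 1 / 2), mul_assoc]
    exact mul_le_mul_of_nonneg_left e2 (by norm_num)
  · rw [intervalIntegrable_iff_integrableOn_Ioc_of_le hst]
    exact (h.integrable.mono_set hsub').const_mul _

end HasSecondDerivBound

lemma abs_mollify_sub_mollify_le (ρ : ContDiffBump (0 : ℝ)) {u : ℝ → ℝ → ℝ} {t x y B : ℝ}
    (hu : Continuous (u t)) (hB : ∀ z, |z| < ρ.rOut → |u t (x - z) - u t (y - z)| ≤ B) :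
    |mollify (ρ.normed volume) u t x - mollify (ρ.normed volume) u t y| ≤ B := by
  have hk0 : Continuous (ρ.normed (volume : Measure ℝ)) := ρ.continuous_normed
  have hkc : HasCompactSupport (ρ.normed (volume : Measure ℝ)) := ρ.hasCompactSupport_normed
  have hi : ∀ x, Integrable fun z => ρ.normed volume z * u t (x - z) := fun x =>
    Continuous.integrable_of_hasCompactSupport (by fun_prop) hkc.mul_right
  have e1 : mollify (ρ.normed volume) u t x - mollify (ρ.normed volume) u t y =
      ∫ z, ρ.normed volume z * (u t (x - z) - u t (y - z)) := by
    simp only [mollify, convolution, mul_sub, integral_sub (hi x) (hi y)]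
    simp
  have e2 : |∫ z, ρ.normed volume z * (u t (x - z) - u t (y - z))| ≤
      ∫ z, ρ.normed volume z * B := by
    refine norm_integral_le_of_norm_le
      (f := fun z => ρ.normed volume z * (u t (x - z) - u t (y - z)))
      ((hk0.integrable_of_hasCompactSupport hkc).mul_const _) (Eventually.of_forall fun z => ?_)
    rw [Real.norm_eq_abs, abs_mul, abs_of_nonneg (ρ.nonneg_normed _)]
    by_cases hz : |z| < ρ.rOut
    · exact mul_le_mul_of_nonneg_left (hB z hz) (ρ.nonneg_normed _)
    · have h5 : ρ.normed volume z = 0 := by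
        have h6 : z ∉ support (ρ.normed (volume : Measure ℝ)) := by
          rw [ρ.support_normed_eq, mem_ball_zero_iff, Real.norm_eq_abs]
          exact hz
        simpa using h6
      rw [h5]
      simp
  rw [integral_mul_const, ρ.integral_normed, one_mul] at e2
  rwa [e1]

lemma abs_sqrt_sub_sqrt_mul {a b : ℝ} (ha : 0 ≤ a) (hb : 0 ≤ b) :
    |√a - √b| * (√a + √b) = |a - b| := by
  rw [← abs_of_nonneg (add_nonneg (Real.sqrt_nonneg a) (Real.sqrt_nonneg b)), ← abs_mul]
  congr 1
  linear_combination Real.sq_sqrt ha - Real.sq_sqrt hb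

namespace HasSecondDerivBound

variable {T S : ℝ} {u : ℝ → ℝ → ℝ} {g : ℝ → ℝ}

/-- Local increments of the solution at times `t ≥ t₀`, in terms of the Lipschitz constant of
`√u(t₀,·)`. -/
lemma abs_sub_le (h : HasSecondDerivBound T S u g) {t₀ M₀ C x₀ : ℝ} (ht₀ : t₀ ∈ Icc 0 S)
    (hM₀ : 0 < M₀) (hL : ∀ x y, |√(u t₀ x) - √(u t₀ y)| ≤ M₀ * |x - y|)
    (hC : Real.exp (∫ τ in Ioc 0 S, 1 / 2 * g τ) = C) (hx₀ : 0 < u t₀ x₀)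
    {t x : ℝ} (ht : t ∈ Icc t₀ S) (hx : |x - x₀| ≤ √(u t₀ x₀) / M₀) :
    |u t x - u t x₀| ≤ (12 + 36 * C) * M₀ * √(u t₀ x₀) * |x - x₀| +
      9 * C * u t₀ x₀ / (√(u t₀ x₀) / M₀) ^ 2 * (x - x₀) ^ 2 := by
  have hreg := h.weak.2.1
  have hu0 : ∀ τ ∈ Icc 0 S, ∀ x, 0 ≤ u τ x := fun τ hτ => h.weak.1 τ (h.Icc_subset hτ)
  have hCpos : 0 < C := hC ▸ Real.exp_pos _
  have htime : ∀ τ ∈ Icc 0 S, ∀ x, u τ x ≤ C * u t₀ x := fun τ hτ x =>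
    hC ▸ h.le_exp_mul ht₀ hτ x
  have hsub : Icc t₀ S ⊆ Icc 0 S := Icc_subset_Icc_left ht₀.1
  set a := u t₀ x₀ with ha
  set b := √a with hb
  have hb0 : 0 < b := Real.sqrt_pos.2 hx₀
  have hab : b ^ 2 = a := Real.sq_sqrt hx₀.le
  set r := b / M₀ with hr
  have hr0 : 0 < r := by positivity
  have hMr : M₀ * r = b := by rw [hr]; field_simp
  have hsqrt : ∀ c, ∀ y, |y - x₀| ≤ c * r → √(u t₀ y) ≤ (1 + c) * b := by
    intro c y hy
    have h1 := (le_abs_self _).trans (hL y x₀)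
    have h2 := mul_le_mul_of_nonneg_left hy hM₀.le
    have h3 : M₀ * (c * r) = c * b := by rw [← hMr]; ring
    linarith
  have hN : ∀ τ ∈ Icc 0 S, ∀ y, |y - x₀| ≤ r → u τ y ≤ 4 * C * a := by
    intro τ hτ y hy
    have h1 := hsqrt 1 y (by linarith)
    have h2 : u t₀ y ≤ 4 * a := by
      rw [← Real.sq_sqrt (hu0 t₀ ht₀ y), ← hab]
      nlinarith [Real.sqrt_nonneg (u t₀ y)]
    nlinarith [htime τ hτ y]
  have hLip : ∀ y z, |y - x₀| ≤ 2 * r → |z - x₀| ≤ 2 * r →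
      |u t₀ y - u t₀ z| ≤ 6 * M₀ * b * |y - z| := by
    intro y z hy hz
    rw [← abs_sqrt_sub_sqrt_mul (hu0 t₀ ht₀ y) (hu0 t₀ ht₀ z)]
    have h1 := hsqrt 2 y hy
    have h2 := hsqrt 2 z hz
    have h3 := hL y z
    calc |√(u t₀ y) - √(u t₀ z)| * (√(u t₀ y) + √(u t₀ z)) ≤ M₀ * |y - z| * (6 * b) := by
          gcongr
          linarith
      _ = 6 * M₀ * b * |y - z| := by ring
  have hI : ∀ y, y ∈ Icc (x₀ - r) (x₀ + r) ↔ |y - x₀| ≤ r := fun y => by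
    rw [abs_sub_le_iff, mem_Icc]
    constructor <;> rintro ⟨h1, h2⟩ <;> constructor <;> linarith
  have hcomp : IsCompact (Icc 0 S ×ˢ Icc (x₀ - 2 * r) (x₀ + 2 * r)) :=
    isCompact_Icc.prod isCompact_Icc
  have hunif := hcomp.uniformContinuousOn_of_continuous
    (hreg.1.mono (prod_mono h.Icc_subset (subset_univ _)))
  set G := ∫ τ in Ioc 0 S, g τ with hG
  have hG0 : 0 ≤ G := setIntegral_nonneg_of_ae_restrict h.nonneg_bound
  have key : ∀ δ, 0 < δ → δ ≤ C * a → |u t x - u t x₀| ≤ (12 + 36 * C) * M₀ * b * |x - x₀| +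
      9 * C * a / r ^ 2 * (x - x₀) ^ 2 + δ * (2 + G) := by
    intro δ hδ hδa
    obtain ⟨d', hd', hdu'⟩ := Metric.uniformContinuousOn_iff.1 hunif δ hδ
    obtain ⟨d, hd, hdr, hdu⟩ : ∃ d, 0 < d ∧ d ≤ r ∧ ∀ τ ∈ Icc 0 S, ∀ z, |z - x₀| ≤ r → ∀ y,
        |y - z| < d → |u τ y - u τ z| ≤ δ := by
      refine ⟨min d' r, lt_min hd' hr0, min_le_right _ _, fun τ hτ z hz y hy => ?_⟩
      have hy' := lt_min_iff.1 hy
      have h1 := (hI z).2 hz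
      have h2 := abs_lt.1 hy'.2
      refine (hdu' (τ, y) ⟨hτ, ⟨by linarith [h1.1], by linarith [h1.2]⟩⟩ (τ, z)
        ⟨hτ, ⟨by linarith [h1.1], by linarith [h1.2]⟩⟩ ?_).le
      simpa [Prod.dist_eq, Real.dist_eq, hd'] using hy'.1
    let ρ : ContDiffBump (0 : ℝ) := ⟨d / 2, d, by linarith, by linarith⟩
    set k := ρ.normed (volume : Measure ℝ) with hk
    have hkd : ContDiff ℝ (⊤ : ℕ∞) k := ρ.contDiff_normed
    have hkc : HasCompactSupport k := ρ.hasCompactSupport_normed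
    have hk1 : ContDiff ℝ (⊤ : ℕ∞) (deriv k) := hkd.deriv'
    have hk2 : ContDiff ℝ (⊤ : ℕ∞) (deriv (deriv k)) := hk1.deriv'
    have hclose : ∀ τ ∈ Icc 0 S, ∀ z, |z - x₀| ≤ r → |mollify k u τ z - u τ z| ≤ δ := by
      intro τ hτ z hz
      refine ρ.dist_normed_convolution_le (hreg.continuous (h.Icc_subset hτ)).aestronglyMeasurable
        fun y hy => hdu τ hτ z hz y hy
    have hcu : ContinuousOn (uncurry u) (Icc t₀ S ×ˢ univ) :=
      hreg.1.mono (prod_mono (hsub.trans h.Icc_subset) subset_rfl)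
    have hct : ∀ τ ∈ Icc t₀ S, Continuous (u τ) := fun τ hτ =>
      hreg.continuous (h.Icc_subset (hsub hτ))
    have hgi : ∀ s ∈ Icc 0 S, ∀ t ∈ Icc 0 S,
        IntervalIntegrable (fun τ => 1 / 2 * δ * g τ) volume s t := by
      intro s hs t ht
      rw [intervalIntegrable_iff]
      exact (h.integrable.mono_set (Ioc_subset_Ioc (le_min hs.1 ht.1) (max_le hs.2 ht.2))).const_mul _
    have hslice : ∀ {f : ℝ → ℝ → ℝ}, ContinuousOn (uncurry f) (Icc t₀ S ×ˢ univ) → ∀ x,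
        ContinuousOn (fun τ => f τ x) (Icc t₀ S) := fun hf x =>
      hf.comp (f := fun τ => (τ, x)) (by fun_prop) fun τ hτ => ⟨hτ, mem_univ _⟩
    have hmain := abs_sub_le_of_approx_heat (w := mollify k u) (w₁ := mollify (deriv k) u)
      (w₂ := mollify (deriv (deriv k)) u) (a := u) (h := fun t => ∫ τ in t₀..t, 1 / 2 * δ * g τ)
      (t₀ := t₀) (t₁ := S) (x₀ := x₀) (r := r) (N := 9 * C * a) (L₀ := 6 * M₀ * b)
      (M := (12 + 36 * C) * M₀ * b) (t := t) (x := x) (y := x₀) hr0 (by positivity)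
      (by nlinarith [mul_pos (mul_pos hCpos hM₀) hb0]) ?_
      (continuousOn_mollify hkd.continuous hkc hcu)
      (fun τ hτ => hasDerivAt_mollify hkd hkc (hct τ hτ))
      (fun τ hτ => hasDerivAt_mollify hk1 hkc.deriv (hct τ hτ))
      (hslice (continuousOn_mollify hk2.continuous hkc.deriv.deriv hcu)) (hslice hcu)
      (fun τ hτ => hu0 τ (hsub hτ)) ?_ ?_ ?_ ?_ ht ((hI x).2 hx) ((hI x₀).2 (by simpa using hr0.le))
    · have hgt : ∫ τ in t₀..t, 1 / 2 * δ * g τ ≤ 1 / 2 * δ * G := by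
        rw [intervalIntegral.integral_of_le ht.1, integral_const_mul]
        gcongr
        exact setIntegral_mono_set h.integrable h.nonneg_bound
          (Ioc_subset_Ioc ht₀.1 ht.2).eventuallyLE
      have h1 := hclose t (hsub ht) x hx
      have h2 := hclose t (hsub ht) x₀ (by simpa using hr0.le)
      simp only [intervalIntegral.integral_same, sub_self, sub_zero, ne_eq, OfNat.ofNat_ne_zero,
        not_false_eq_true, zero_pow, add_zero] at hmain
      rw [abs_le] at *
      constructor <;> linarith [h1.1, h1.2, h2.1, h2.2, hmain.1, hmain.2]
    · have h1 : 4 * (9 * C * a) / r = 36 * C * M₀ * b := by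
        rw [hr, ← hab]
        field_simp
        ring
      rw [h1]
      nlinarith [mul_pos hM₀ hb0]
    · rw [← uIcc_of_le ht₀.2]
      exact intervalIntegral.continuousOn_primitive_interval'
        (hgi _ ht₀ _ (right_mem_Icc.2 h.pos.le)) left_mem_uIcc
    · intro z hz s hs t ht hst
      rw [intervalIntegral.integral_interval_sub_left (hgi _ ht₀ _ (hsub ht))
        (hgi _ ht₀ _ (hsub hs))]
      exact h.abs_mollify_sub_le ρ (hsub hs) (hsub ht) hst fun τ hτ y hy =>
        hdu τ hτ z ((hI z).1 hz) y hy
    · intro τ hτ z hz y hy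
      rw [hI] at hz hy
      have h1 := abs_le.1 (hclose τ (hsub hτ) z hz)
      have h2 := abs_le.1 (hclose τ (hsub hτ) y hy)
      have h3 := hN τ (hsub hτ) z hz
      have h4 := hu0 τ (hsub hτ) y
      have h5 : 0 < C * a := by positivity
      linarith [h1.2, h2.1]
    · intro z hz y hy
      rw [hI] at hz hy
      refine abs_mollify_sub_mollify_le ρ (hct t₀ ⟨le_rfl, ht₀.2⟩) fun q hq => ?_
      have h1 : |q| ≤ r := hq.le.trans hdr
      have h2 : ∀ z, |z - x₀| ≤ r → |z - q - x₀| ≤ 2 * r := fun z hz => by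
        rw [abs_le] at *
        constructor <;> linarith [hz.1, hz.2, h1.1, h1.2]
      simpa using hLip (z - q) (y - q) (h2 z hz) (h2 y hy)
  refine le_of_forall_pos_le_add fun ε hε => ?_
  have hpos : 0 < min (C * a) (ε / (2 + G)) := by positivity
  refine (key _ hpos (min_le_left _ _)).trans ?_
  gcongr
  exact (le_div_iff₀ (by positivity)).1 (min_le_right _ _)

end HasSecondDerivBound

namespace HasSecondDerivBound

variable {T S : ℝ} {u : ℝ → ℝ → ℝ} {g : ℝ → ℝ}

/-- Lipschitz continuity of `√u(t₀,·)` propagates to later times. -/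
lemma exists_lipschitzWith_sqrt_forward (h : HasSecondDerivBound T S u g) {t₀ : ℝ}
    (ht₀ : t₀ ∈ Icc 0 S) {M₀ : NNReal} (hL : LipschitzWith M₀ fun x => √(u t₀ x)) :
    ∃ M : NNReal, ∀ t ∈ Icc t₀ S, LipschitzWith M fun x => √(u t x) := by
  set C := Real.exp (∫ τ in Ioc 0 S, 1 / 2 * g τ) with hC
  have hCpos : 0 < C := Real.exp_pos _
  have hL' : ∀ x y, |√(u t₀ x) - √(u t₀ y)| ≤ ((M₀ : ℝ) + 1) * |x - y| := fun x y => by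
    have := hL.dist_le_mul x y
    rw [Real.dist_eq, Real.dist_eq] at this
    linarith [abs_nonneg (x - y)]
  have hM₀ : 0 < (M₀ : ℝ) + 1 := by positivity
  have hM : 0 ≤ √C * ((12 + 36 * C) * ((M₀ : ℝ) + 1)) + 1 := by positivity
  refine ⟨⟨_, hM⟩, fun t ht => ?_⟩
  have htS : t ∈ Icc 0 S := ⟨ht₀.1.trans ht.1, ht.2⟩
  have hut := h.weak.1 t (h.Icc_subset htS)
  refine lipschitzWith_of_eventually_slope_le (h.weak.2.1.continuous (h.Icc_subset htS)).sqrt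
    (fun x => Real.sqrt_nonneg _) fun x₀ hx₀ => ?_
  rw [Real.sqrt_pos] at hx₀
  have hle := h.le_exp_mul ht₀ htS x₀
  have hge := h.le_exp_mul htS ht₀ x₀
  rw [← hC] at hle hge
  have ha : 0 < u t₀ x₀ := pos_of_mul_pos_right (hx₀.trans_le hle) hCpos.le
  set b := √(u t₀ x₀) with hb
  have hb0 : 0 < b := Real.sqrt_pos.2 ha
  have hbC : b ≤ √C * √(u t x₀) := by
    rw [← Real.sqrt_mul hCpos.le]
    exact Real.sqrt_le_sqrt hge
  have hs : 0 < √(u t x₀) := Real.sqrt_pos.2 hx₀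
  set K := 9 * C * u t₀ x₀ / (b / ((M₀ : ℝ) + 1)) ^ 2 with hK
  have hK0 : 0 < K := by positivity
  have e1 : ∀ᶠ x in 𝓝 x₀, |x - x₀| < min (b / ((M₀ : ℝ) + 1)) (√(u t x₀) / K) :=
    Metric.ball_mem_nhds x₀ (lt_min (by positivity) (by positivity))
  filter_upwards [e1] with x hx
  have h1 := h.abs_sub_le ht₀ hM₀ hL' hC.symm ha ht (hx.le.trans (min_le_left _ _))
  rw [← hb, ← hK] at h1
  have h2 : K * |x - x₀| ≤ √(u t x₀) := by
    rw [mul_comm]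
    exact (le_div_iff₀ hK0).1 (hx.le.trans (min_le_right _ _))
  have h3 := abs_sqrt_sub_sqrt_mul (hut x) (hut x₀)
  refine le_of_mul_le_mul_right ?_ hs
  calc |√(u t x) - √(u t x₀)| * √(u t x₀)
      ≤ |√(u t x) - √(u t x₀)| * (√(u t x) + √(u t x₀)) := by
        gcongr
        linarith [Real.sqrt_nonneg (u t x)]
    _ = |u t x - u t x₀| := h3
    _ ≤ _ := h1
    _ = ((12 + 36 * C) * ((M₀ : ℝ) + 1) * b + K * |x - x₀|) * |x - x₀| := by
        rw [← sq_abs (x - x₀)]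
        ring
    _ ≤ ((12 + 36 * C) * ((M₀ : ℝ) + 1) * (√C * √(u t x₀)) + √(u t x₀)) * |x - x₀| := by
        gcongr
    _ = (√C * ((12 + 36 * C) * ((M₀ : ℝ) + 1)) + 1) * |x - x₀| * √(u t x₀) := by ring

end HasSecondDerivBound

lemma IsStrongSolution.exists_hasSecondDerivBound {T S : ℝ} {u : ℝ → ℝ → ℝ}
    (hu : IsStrongSolution T u) (hS : 0 < S) (hST : S < T) : ∃ g, HasSecondDerivBound T S u g := by
  obtain ⟨g, hg, hgood⟩ := (hu.2 S hS hST).2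
  refine ⟨g, hu.1, hS, hST, hg.mono_set Ioc_subset_Icc_self, ?_, ?_, ?_⟩
  · filter_upwards [hgood] with t ht using fun x => (ht.1 x).1
  · filter_upwards [hgood] with t ht using fun x => (ht.1 x).2
  · filter_upwards [hgood] with t ht using ht.2

/-- A strong solution on `[0,T)` is root-Lipschitz uniformly on
each `[T₁,T₂] ⊂ (0,T)`; if moreover `u(0,·)` is differentiable with Lipschitz
derivative, the same holds with `T₁ = 0`. -/
theorem strong_implies_root_lipschitz
    (T : ℝ) (u : ℝ → ℝ → ℝ) (hu : IsStrongSolution T u) :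
    (∀ T₁ T₂ : ℝ, 0 < T₁ → T₁ ≤ T₂ → T₂ < T →
      ∃ M : NNReal, ∀ t ∈ Icc T₁ T₂,
        LipschitzWith M (fun x => Real.sqrt (u t x))) ∧
    ((Differentiable ℝ (u 0) ∧ ∃ L : NNReal, LipschitzWith L (deriv (u 0))) →
      ∀ T₂ : ℝ, 0 ≤ T₂ → T₂ < T →
        ∃ M : NNReal, ∀ t ∈ Icc (0:ℝ) T₂,
          LipschitzWith M (fun x => Real.sqrt (u t x))) := by
  constructor
  · intro T₁ T₂ h₁ h₁₂ h₂
    obtain ⟨S, hS₁, hS₂⟩ := exists_between h₂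
    obtain ⟨g, h⟩ := hu.exists_hasSecondDerivBound (h₁.trans_le (h₁₂.trans hS₁.le)) hS₂
    have hsub : Ioc 0 T₁ ⊆ Ioc 0 S := Ioc_subset_Ioc_right (h₁₂.trans hS₁.le)
    have hne : (ae (volume.restrict (Ioc 0 T₁))).NeBot := by
      rw [ae_neBot, Ne, Measure.restrict_eq_zero]
      simpa using h₁
    obtain ⟨t₀, hd, hd', hb, ht₀⟩ := (((ae_restrict_of_ae_restrict_of_subset hsub
      h.differentiable).and <| (ae_restrict_of_ae_restrict_of_subset hsub
      h.differentiable_deriv).and <| (ae_restrict_of_ae_restrict_of_subset hsub h.bound).and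
      (ae_restrict_mem measurableSet_Ioc))).exists
    have ht₀S : t₀ ∈ Icc 0 S := Ioc_subset_Icc_self (hsub ht₀)
    have hg0 : 0 ≤ g t₀ := (abs_nonneg _).trans (hb 0)
    obtain ⟨M₀, hM₀⟩ := exists_lipschitzWith_sqrt (h.weak.1 t₀ (h.Icc_subset ht₀S)) hd
      (lipschitzWith_of_nnnorm_deriv_le (C := ⟨g t₀, hg0⟩) hd' hb)
    obtain ⟨M, hM⟩ := h.exists_lipschitzWith_sqrt_forward ht₀S hM₀
    exact ⟨M, fun t ht => hM t ⟨ht₀.2.trans ht.1, ht.2.trans hS₁.le⟩⟩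
  · rintro ⟨hd, L, hL⟩ T₂ h₀ h₂
    obtain ⟨S, hS₁, hS₂⟩ := exists_between h₂
    obtain ⟨g, h⟩ := hu.exists_hasSecondDerivBound (h₀.trans_lt hS₁) hS₂
    have h0S : (0 : ℝ) ∈ Icc 0 S := left_mem_Icc.2 h.pos.le
    obtain ⟨M₀, hM₀⟩ := exists_lipschitzWith_sqrt (h.weak.1 0 (h.Icc_subset h0S)) hd hL
    obtain ⟨M, hM⟩ := h.exists_lipschitzWith_sqrt_forward h0S hM₀
    exact ⟨M, fun t ht => hM t ⟨ht.1, ht.2.trans hS₁.le⟩⟩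
end
end

section
/- If u is a strong solution of ∂_t u = (1/2) u ∂_x² u on a time interval [0,T), then the zero set is exactly preserved in time: for every t ∈ [0,T), {x ∈ ℝ : u(t,x) = 0} = {x ∈ ℝ : u(0,x) = 0}. -/
open MeasureTheory Set Filter

noncomputable section

lemma abs_integral_mul_sub_le {p h : ℝ → ℝ} {c κ : ℝ} (hp0 : ∀ x, 0 ≤ p x)
    (hp1 : ∫ x, p x = 1) (hp : Integrable p) (hph : Integrable fun x => p x * h x)
    (hclose : ∀ x, p x ≠ 0 → |h x - c| ≤ κ) : |(∫ x, p x * h x) - c| ≤ κ := by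
  have e : (∫ x, p x * h x) - c = ∫ x, (p x * h x - p x * c) := by
    rw [integral_sub hph (hp.mul_const c), integral_mul_const, hp1, one_mul]
  have e2 : κ = ∫ x, p x * κ := by rw [integral_mul_const, hp1, one_mul]
  rw [e, e2, ← Real.norm_eq_abs]
  refine norm_integral_le_of_norm_le (hp.mul_const κ) (ae_of_all _ fun x => ?_)
  rw [← mul_sub, norm_mul, Real.norm_of_nonneg (hp0 x), Real.norm_eq_abs]
  by_cases hx : p x = 0
  · simp [hx]
  · exact mul_le_mul_of_nonneg_left (hclose x hx) (hp0 x)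

lemma exists_smooth_bump (c : ℝ) {ε : ℝ} (hε : 0 < ε) :
    ∃ p : ℝ → ℝ, ContDiff ℝ (⊤ : ℕ∞) p ∧ HasCompactSupport p ∧ (∀ x, 0 ≤ p x) ∧
      ∫ x, p x = 1 ∧ ∀ x, p x ≠ 0 → |x - c| < ε := by
  let B : ContDiffBump c := ⟨ε / 2, ε, by positivity, by linarith⟩
  refine ⟨B.normed volume, B.contDiff_normed, B.hasCompactSupport_normed,
    B.nonneg_normed, B.integral_normed, fun x hx => ?_⟩
  have : x ∈ Function.support (B.normed volume) := hx
  rw [B.support_normed_eq] at this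
  exact this

lemma exists_smooth_cutoff {a b s t ε : ℝ} (hs : s ∈ Ioo a b) (ht : t ∈ Ioo a b) (hε : 0 < ε) :
    ∃ χ p q : ℝ → ℝ, ContDiff ℝ (⊤ : ℕ∞) χ ∧ (∀ r, r ∉ Icc a b → χ r = 0) ∧ χ a = 0 ∧
      (∀ r, |χ r| ≤ 1) ∧ (∀ r, deriv χ r = p r - q r) ∧
      (Continuous p ∧ HasCompactSupport p ∧ (∀ r, 0 ≤ p r) ∧ ∫ r, p r = 1 ∧
        ∀ r, p r ≠ 0 → |r - s| < ε ∧ r ∈ Ioo a b) ∧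
      (Continuous q ∧ HasCompactSupport q ∧ (∀ r, 0 ≤ q r) ∧ ∫ r, q r = 1 ∧
        ∀ r, q r ≠ 0 → |r - t| < ε ∧ r ∈ Ioo a b) := by
  have key : ∀ c ∈ Ioo a b, ∃ p : ℝ → ℝ, ContDiff ℝ (⊤ : ℕ∞) p ∧ HasCompactSupport p ∧
      (∀ x, 0 ≤ p x) ∧ ∫ x, p x = 1 ∧ ∀ x, p x ≠ 0 → |x - c| < ε ∧ x ∈ Ioo a b := by
    intro c hc
    obtain ⟨p, h1, h2, h3, h4, h5⟩ := exists_smooth_bump c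
      (lt_min hε (lt_min (sub_pos.2 hc.1) (sub_pos.2 hc.2)))
    refine ⟨p, h1, h2, h3, h4, fun x hx => ?_⟩
    have := h5 x hx
    rw [lt_min_iff, lt_min_iff, abs_lt, abs_lt, abs_lt] at this
    rw [abs_lt]
    exact ⟨this.1, by linarith [this.2.1.1], by linarith [this.2.2.2]⟩
  have key2 : ∀ p : ℝ → ℝ, Continuous p → HasCompactSupport p → (∀ x, 0 ≤ p x) →
      ∫ x, p x = 1 → (∀ x, p x ≠ 0 → x ∈ Ioo a b) →
      (∀ r, r ≤ a → ∫ x in a..r, p x = 0) ∧ (∀ r, b ≤ r → ∫ x in a..r, p x = 1) ∧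
      ∀ r, 0 ≤ ∫ x in a..r, p x ∧ ∫ x in a..r, p x ≤ 1 := by
    intro p hc hcs h0 h1 hsupp
    have hz : ∀ x, x ∉ Ioo a b → p x = 0 := fun x hx => by
      by_contra h; exact hx (hsupp x h)
    have hA : ∀ r, r ≤ a → ∫ x in a..r, p x = 0 := by
      intro r hr
      rw [intervalIntegral.integral_congr (g := fun _ => 0)]
      · simp
      · intro x hx
        rw [uIcc_of_ge hr] at hx
        exact hz x fun h => not_lt.2 hx.2 h.1
    refine ⟨hA, ?_, ?_⟩
    · intro r hr
      rw [intervalIntegral.integral_of_le ((hs.1.trans hs.2).le.trans hr), ← h1]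
      refine setIntegral_eq_integral_of_forall_compl_eq_zero fun x hx => hz x fun h => hx ?_
      exact ⟨h.1, h.2.le.trans hr⟩
    · intro r
      rcases le_total r a with hr | hr
      · rw [hA r hr]; norm_num
      · refine ⟨intervalIntegral.integral_nonneg hr fun x _ => h0 x, ?_⟩
        rw [intervalIntegral.integral_of_le hr, ← h1]
        exact setIntegral_le_integral (hc.integrable_of_hasCompactSupport hcs)
          (ae_of_all _ h0)
  obtain ⟨p, p1, p2, p3, p4, p5⟩ := key s hs
  obtain ⟨q, q1, q2, q3, q4, q5⟩ := key t ht
  obtain ⟨pA, pB, pC⟩ := key2 p p1.continuous p2 p3 p4 fun x hx => (p5 x hx).2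
  obtain ⟨qA, qB, qC⟩ := key2 q q1.continuous q2 q3 q4 fun x hx => (q5 x hx).2
  have hd : ∀ r, HasDerivAt (fun r => (∫ x in a..r, p x) - ∫ x in a..r, q x) (p r - q r) r :=
    fun r => (p1.continuous.integral_hasStrictDerivAt a r).hasDerivAt.sub
      (q1.continuous.integral_hasStrictDerivAt a r).hasDerivAt
  refine ⟨fun r => (∫ x in a..r, p x) - ∫ x in a..r, q x, p, q, ?_, ?_, ?_, ?_,
    fun r => (hd r).deriv, ⟨p1.continuous, p2, p3, p4, p5⟩, ⟨q1.continuous, q2, q3, q4, q5⟩⟩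
  · rw [contDiff_infty_iff_deriv]
    refine ⟨fun r => (hd r).differentiableAt, ?_⟩
    rw [show deriv (fun r => (∫ x in a..r, p x) - ∫ x in a..r, q x) = fun r => p r - q r from
      funext fun r => (hd r).deriv]
    exact p1.sub q1
  · intro r hr
    rw [mem_Icc, not_and_or, not_le, not_le] at hr
    rcases hr with hr | hr
    · simp [pA r hr.le, qA r hr.le]
    · simp [pB r hr.le, qB r hr.le]
  · simp
  · intro r
    rw [abs_le]
    constructor <;> linarith [(pC r).1, (pC r).2, (qC r).1, (qC r).2]

lemma integrable_deriv_mul_deriv {φ w : ℝ → ℝ} (hφ : ContDiff ℝ (⊤ : ℕ∞) φ)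
    (hφc : HasCompactSupport φ) (hw : Differentiable ℝ w) (hw' : Continuous (deriv w)) :
    Integrable fun x => deriv (fun y => φ y * w y) x * deriv w x := by
  have hφd : Differentiable ℝ φ := hφ.differentiable (by simp)
  have hφ' : Continuous (deriv φ) := hφ.continuous_deriv (by simp)
  have e : deriv (fun y => φ y * w y) = fun x => deriv φ x * w x + φ x * deriv w x :=
    funext fun x => deriv_fun_mul (hφd x) (hw x)
  rw [e]
  refine Continuous.integrable_of_hasCompactSupport
    (((hφ'.mul hw.continuous).add (hφ.continuous.mul hw')).mul hw') ?_
  exact ((hφc.deriv.mul_right (f' := w)).add (hφc.mul_right (f' := deriv w))).mul_right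

lemma abs_integral_deriv_mul_deriv_le {φ w : ℝ → ℝ} {M G : ℝ}
    (hφ : ContDiff ℝ (⊤ : ℕ∞) φ) (hφc : HasCompactSupport φ) (hφ0 : ∀ x, 0 ≤ φ x)
    (hφ1 : ∫ x, φ x = 1) (hw : Differentiable ℝ w) (hw' : Differentiable ℝ (deriv w))
    (hG : ∀ x, |deriv (deriv w) x| ≤ G) (hM : ∀ x, φ x ≠ 0 → |w x| ≤ M) :
    |∫ x, deriv (fun y => φ y * w y) x * deriv w x| ≤ M * G := by
  have hφd : Differentiable ℝ φ := hφ.differentiable (by simp)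
  have hc : Continuous fun x => φ x * w x := hφ.continuous.mul hw.continuous
  have hcs : HasCompactSupport fun x => φ x * w x := hφc.mul_right
  have hint : Integrable ((fun x => φ x * w x) * deriv (deriv w)) := by
    refine (hc.integrable_of_hasCompactSupport hcs).mul_bdd
      (c := G) (measurable_deriv _).aestronglyMeasurable (ae_of_all _ hG)
  have parts := integral_mul_deriv_eq_deriv_mul_of_integrable
    (u := fun x => φ x * w x) (v := deriv w) (u' := deriv fun x => φ x * w x)
    (v' := deriv (deriv w)) (fun x _ => ((hφd x).fun_mul (hw x)).hasDerivAt)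
    (fun x _ => (hw' x).hasDerivAt) hint
    (integrable_deriv_mul_deriv hφ hφc hw hw'.continuous)
    ((hc.mul hw'.continuous).integrable_of_hasCompactSupport hcs.mul_right)
  rw [← abs_neg, ← parts, ← Real.norm_eq_abs]
  have e : M * G = ∫ x, φ x * (M * G) := by rw [integral_mul_const, hφ1, one_mul]
  rw [e]
  refine norm_integral_le_of_norm_le
    ((hφ.continuous.integrable_of_hasCompactSupport hφc).mul_const _) (ae_of_all _ fun x => ?_)
  rw [mul_assoc, norm_mul, norm_mul, Real.norm_of_nonneg (hφ0 x), Real.norm_eq_abs,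
    Real.norm_eq_abs]
  by_cases hx : φ x = 0
  · simp [hx]
  · exact mul_le_mul_of_nonneg_left (mul_le_mul (hM x hx) (hG x) (abs_nonneg _)
      ((abs_nonneg _).trans (hM x hx))) (hφ0 x)

/-- The weak formulation tested against `χ(t) φ(x)`, with the spatial integrals separated. -/
lemma WeakForm.integral_deriv_mul_eq {T a b : ℝ} {u v : ℝ → ℝ → ℝ} {χ φ : ℝ → ℝ}
    (hu : WeakForm T u) (ha : 0 ≤ a) (hbT : b < T)
    (hv : Continuous (Function.uncurry v)) (huv : ∀ t ∈ Icc a b, u t = v t)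
    (hdiff : ∀ᵐ t, t ∈ Ioc a b → Differentiable ℝ (v t) ∧ Continuous (deriv (v t)))
    (hχ : ContDiff ℝ (⊤ : ℕ∞) χ) (hχs : ∀ r, r ∉ Icc a b → χ r = 0) (hχa : χ a = 0)
    (hφ : ContDiff ℝ (⊤ : ℕ∞) φ) (hφc : HasCompactSupport φ) :
    ∫ t in Ioc a b, (deriv χ t * (∫ x, φ x * v t x)
      - 1 / 2 * (χ t * ∫ x, deriv (fun y => φ y * v t y) x * deriv (v t) x)) = 0 := by
  have hsup : Function.support (Function.uncurry fun t x => χ t * φ x) ⊆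
      Icc a b ×ˢ tsupport φ := by
    rintro ⟨t, x⟩ h
    simp only [Function.mem_support, Function.uncurry_apply_pair, ne_eq, mul_eq_zero,
      not_or] at h
    exact ⟨by_contra fun h' => h.1 (hχs t h'), subset_tsupport _ h.2⟩
  have hcpt : IsCompact (Icc a b ×ˢ tsupport φ) := isCompact_Icc.prod hφc
  have hχ0 : χ 0 = 0 := by
    rcases ha.eq_or_lt with h | h
    · rwa [← h] at hχa
    · exact hχs 0 fun h' => not_le.2 h h'.1
  have hχd : ∀ r, r ∉ Icc a b → deriv χ r = 0 := by
    intro r hr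
    have : χ =ᶠ[nhds r] fun _ => 0 := by
      filter_upwards [isClosed_Icc.isOpen_compl.mem_nhds hr] with y hy using hχs y hy
    rw [this.deriv_eq, deriv_const]
  have key := hu (fun t x => χ t * φ x)
    ((hχ.comp contDiff_fst).mul (hφ.comp contDiff_snd))
    (HasCompactSupport.of_support_subset_isCompact hcpt hsup)
    ((closure_minimal hsup hcpt.isClosed).trans
      (prod_mono (fun t ht => lt_of_le_of_lt ht.2 hbT) (subset_univ _)))
  simp only [hχ0, zero_mul, mul_zero, integral_zero, zero_add] at key
  have hvt : ∀ t, Continuous (v t) := fun t => hv.comp (Continuous.prodMk_right t)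
  have hd1 : ∀ t x, deriv (fun s => χ s * φ x) t = deriv χ t * φ x := fun t x =>
    deriv_mul_const (hχ.differentiable (by simp) t) _
  have hd2 : ∀ t x, deriv (fun y => χ t * φ y * u t y) x =
      χ t * deriv (fun y => φ y * u t y) x := fun t x => by
    simp_rw [mul_assoc]; exact deriv_const_mul_field _
  simp_rw [hd1, hd2] at key
  have hsub : Icc a b ⊆ Ico 0 T := fun t ht => ⟨ha.trans ht.1, ht.2.trans_lt hbT⟩
  rw [setIntegral_eq_of_subset_of_forall_sdiff_eq_zero measurableSet_Ico hsub
      (fun t ht => by simp [hχd t ht.2, hχs t ht.2]), integral_Icc_eq_integral_Ioc] at key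
  rw [← key]
  refine setIntegral_congr_ae measurableSet_Ioc ?_
  filter_upwards [hdiff] with t ht htm
  obtain ⟨h1, h2⟩ := ht htm
  rw [huv t (Ioc_subset_Icc_self htm), ← integral_const_mul, ← integral_const_mul,
    ← integral_const_mul, ← integral_sub]
  · exact integral_congr_ae (ae_of_all _ fun x => by ring)
  · exact ((hφ.continuous.mul (hvt t)).integrable_of_hasCompactSupport
      hφc.mul_right).const_mul _
  · exact ((integrable_deriv_mul_deriv hφ hφc h1 h2).const_mul _).const_mul _

lemma WeakForm.abs_sub_le_of_lt {T a b s t δ M x₀ : ℝ} {u v : ℝ → ℝ → ℝ} {g : ℝ → ℝ}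
    (hu : WeakForm T u) (ha : 0 ≤ a) (hbT : b < T)
    (hv : Continuous (Function.uncurry v)) (huv : ∀ t ∈ Icc a b, u t = v t)
    (hg : IntegrableOn g (Ioc a b))
    (hdiff : ∀ᵐ t, t ∈ Ioc a b →
      (∀ x : ℝ, DifferentiableAt ℝ (v t) x ∧ DifferentiableAt ℝ (deriv (v t)) x) ∧
      (∀ x : ℝ, |deriv (deriv (v t)) x| ≤ g t))
    (hδ : 0 < δ) (hM : ∀ r ∈ Icc a b, ∀ x, |x - x₀| < δ → |v r x| ≤ M)
    (hs : s ∈ Ioo a b) (ht : t ∈ Ioo a b) :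
    |v s x₀ - v t x₀| ≤ 1 / 2 * (M * ∫ r in Ioc a b, |g r|) := by
  refine le_of_forall_pos_le_add fun κ hκ => ?_
  have near : ∀ r, ∃ ε > 0, ∀ r' x, |r' - r| < ε → |x - x₀| < ε → |v r' x - v r x₀| ≤ κ / 2 := by
    intro r
    obtain ⟨ε, hε, h⟩ := Metric.continuousAt_iff.1 (hv.continuousAt (x := (r, x₀))) (κ / 2)
      (half_pos hκ)
    refine ⟨ε, hε, fun r' x h1 h2 => (h (x := (r', x)) ?_).le⟩
    rw [Prod.dist_eq]
    exact max_lt h1 h2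
  obtain ⟨ε₁, hε₁, near₁⟩ := near s
  obtain ⟨ε₂, hε₂, near₂⟩ := near t
  have hε := lt_min hε₁ hε₂
  obtain ⟨χ, p, q, hχ, hχs, hχa, hχ1, hχd, ⟨hpc, hps, hp0, hp1, hpn⟩,
    ⟨hqc, hqs, hq0, hq1, hqn⟩⟩ := exists_smooth_cutoff hs ht hε
  obtain ⟨φ, hφ, hφs, hφ0, hφ1, hφn⟩ := exists_smooth_bump x₀ (lt_min hδ hε)
  set U : ℝ → ℝ := fun r => ∫ x, φ x * v r x with hU
  set K : ℝ → ℝ := fun r => ∫ x, deriv (fun y => φ y * v r y) x * deriv (v r) x with hK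
  have hvt : ∀ t, Continuous (v t) := fun t => hv.comp (Continuous.prodMk_right t)
  have hφv : Continuous (Function.uncurry fun r x => φ x * v r x) :=
    (hφ.continuous.comp continuous_snd).mul hv
  have hφi : Integrable φ := hφ.continuous.integrable_of_hasCompactSupport hφs
  have hUc : Continuous U := by
    have := continuous_parametric_integral_of_continuous (μ := volume) hφv hφs.isCompact
    convert this using 2 with r
    refine (setIntegral_eq_integral_of_forall_compl_eq_zero fun x hx => ?_).symm
    rw [image_eq_zero_of_notMem_tsupport hx, zero_mul]
  have hUnear : ∀ r r' ε, min ε₁ ε₂ ≤ ε →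
      (∀ r' x, |r' - r| < ε → |x - x₀| < ε → |v r' x - v r x₀| ≤ κ / 2) →
      |r' - r| < min ε₁ ε₂ → |U r' - v r x₀| ≤ κ / 2 := by
    intro r r' ε hle h hr
    refine abs_integral_mul_sub_le hφ0 hφ1 hφi
      ((hφ.continuous.mul (hvt r')).integrable_of_hasCompactSupport hφs.mul_right)
      fun x hx => h r' x (hr.trans_le hle) ?_
    exact (hφn x hx).trans_le ((min_le_right _ _).trans hle)
  have hpi : Integrable fun r => p r * U r :=
    (hpc.mul hUc).integrable_of_hasCompactSupport hps.mul_right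
  have hqi : Integrable fun r => q r * U r :=
    (hqc.mul hUc).integrable_of_hasCompactSupport hqs.mul_right
  have hP : |(∫ r, p r * U r) - v s x₀| ≤ κ / 2 :=
    abs_integral_mul_sub_le hp0 hp1 (hpc.integrable_of_hasCompactSupport hps) hpi
      fun r hr => hUnear s r ε₁ (min_le_left _ _) near₁ (hpn r hr).1
  have hQ : |(∫ r, q r * U r) - v t x₀| ≤ κ / 2 :=
    abs_integral_mul_sub_le hq0 hq1 (hqc.integrable_of_hasCompactSupport hqs) hqi
      fun r hr => hUnear t r ε₂ (min_le_right _ _) near₂ (hqn r hr).1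
  have hKm : StronglyMeasurable K := by
    have h : Measurable (Function.uncurry fun r x =>
        deriv (fun y => φ y * v r y) x * deriv (v r) x) :=
      (measurable_deriv_with_param hφv).mul (measurable_deriv_with_param hv)
    exact h.stronglyMeasurable.integral_prod_right
  have hχK : ∀ᵐ r ∂(volume.restrict (Ioc a b)), ‖χ r * K r‖ ≤ M * |g r| := by
    rw [ae_restrict_iff' measurableSet_Ioc]
    filter_upwards [hdiff] with r hr hrm
    obtain ⟨h1, h2⟩ := hr hrm
    have hKr : |K r| ≤ M * |g r| :=
      abs_integral_deriv_mul_deriv_le hφ hφs hφ0 hφ1 (fun x => (h1 x).1) (fun x => (h1 x).2)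
        (fun x => (h2 x).trans (le_abs_self _)) fun x hx =>
          hM r (Ioc_subset_Icc_self hrm) x ((hφn x hx).trans_le (min_le_left _ _))
    rw [norm_mul, Real.norm_eq_abs, Real.norm_eq_abs, ← one_mul (M * |g r|)]
    exact mul_le_mul (hχ1 r) hKr (abs_nonneg _) zero_le_one
  have hgi : Integrable (fun r => M * |g r|) (volume.restrict (Ioc a b)) := hg.abs.const_mul M
  have hχKi : Integrable (fun r => χ r * K r) (volume.restrict (Ioc a b)) :=
    hgi.mono' (hχ.continuous.aestronglyMeasurable.mul hKm.aestronglyMeasurable) hχK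
  have hweak := hu.integral_deriv_mul_eq ha hbT hv huv
    (by filter_upwards [hdiff] with r hr hrm
        exact ⟨fun x => ((hr hrm).1 x).1,
          Differentiable.continuous fun x => ((hr hrm).1 x).2⟩) hχ hχs hχa hφ hφs
  have hset : ∀ f : ℝ → ℝ, (∀ r, f r ≠ 0 → r ∈ Ioo a b) →
      ∫ r in Ioc a b, f r * U r = ∫ r, f r * U r := by
    intro f hf
    refine setIntegral_eq_integral_of_forall_compl_eq_zero fun r hr => ?_
    rw [show f r = 0 from by_contra fun h => hr (Ioo_subset_Ioc_self (hf r h)), zero_mul]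
  have hmain : (∫ r, p r * U r) - (∫ r, q r * U r) = 1 / 2 * ∫ r in Ioc a b, χ r * K r := by
    rw [← hset p fun r hr => (hpn r hr).2, ← hset q fun r hr => (hqn r hr).2,
      ← integral_sub hpi.restrict hqi.restrict, ← integral_const_mul, ← sub_eq_zero,
      ← integral_sub (f := fun r => p r * U r - q r * U r)
        (hpi.restrict.sub hqi.restrict) (hχKi.const_mul _), ← hweak]
    refine integral_congr_ae (ae_of_all _ fun r => ?_)
    simp only [hχd, hU, hK]
    ring
  have hbound : |∫ r in Ioc a b, χ r * K r| ≤ M * ∫ r in Ioc a b, |g r| := by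
    rw [← integral_const_mul, ← Real.norm_eq_abs]
    exact norm_integral_le_of_norm_le hgi hχK
  rw [abs_le] at hP hQ hbound ⊢
  constructor <;> linarith [hP.1, hP.2, hQ.1, hQ.2, hbound.1, hbound.2]

lemma WeakForm.abs_sub_le {T a b s t δ M x₀ : ℝ} {u v : ℝ → ℝ → ℝ} {g : ℝ → ℝ}
    (hu : WeakForm T u) (ha : 0 ≤ a) (hab : a < b) (hbT : b < T)
    (hv : Continuous (Function.uncurry v)) (huv : ∀ t ∈ Icc a b, u t = v t)
    (hg : IntegrableOn g (Ioc a b))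
    (hdiff : ∀ᵐ t, t ∈ Ioc a b →
      (∀ x : ℝ, DifferentiableAt ℝ (v t) x ∧ DifferentiableAt ℝ (deriv (v t)) x) ∧
      (∀ x : ℝ, |deriv (deriv (v t)) x| ≤ g t))
    (hδ : 0 < δ) (hM : ∀ r ∈ Icc a b, ∀ x, |x - x₀| < δ → |v r x| ≤ M)
    (hs : s ∈ Icc a b) (ht : t ∈ Icc a b) :
    |v s x₀ - v t x₀| ≤ 1 / 2 * (M * ∫ r in Ioc a b, |g r|) := by
  have hc : Continuous fun r => v r x₀ := hv.comp (Continuous.prodMk_left x₀)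
  have hcl : IsClosed {z : ℝ × ℝ | |v z.1 x₀ - v z.2 x₀| ≤
      1 / 2 * (M * ∫ r in Ioc a b, |g r|)} :=
    isClosed_le ((hc.comp continuous_fst).sub (hc.comp continuous_snd)).abs continuous_const
  have hsub : Ioo a b ×ˢ Ioo a b ⊆ {z : ℝ × ℝ | |v z.1 x₀ - v z.2 x₀| ≤
      1 / 2 * (M * ∫ r in Ioc a b, |g r|)} := fun z hz =>
    hu.abs_sub_le_of_lt ha hbT hv huv hg hdiff hδ hM hz.1 hz.2
  have := closure_minimal hsub hcl
  rw [closure_prod_eq, closure_Ioo hab.ne] at this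
  exact this (show (s, t) ∈ Icc a b ×ˢ Icc a b from ⟨hs, ht⟩)

lemma WeakForm.eq_zero_of_integral_le_one {T a b s t x₀ : ℝ} {u v : ℝ → ℝ → ℝ} {g : ℝ → ℝ}
    (hu : WeakForm T u) (ha : 0 ≤ a) (hab : a < b) (hbT : b < T)
    (hv : Continuous (Function.uncurry v)) (huv : ∀ t ∈ Icc a b, u t = v t)
    (hg : IntegrableOn g (Ioc a b))
    (hdiff : ∀ᵐ t, t ∈ Ioc a b →
      (∀ x : ℝ, DifferentiableAt ℝ (v t) x ∧ DifferentiableAt ℝ (deriv (v t)) x) ∧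
      (∀ x : ℝ, |deriv (deriv (v t)) x| ≤ g t))
    (hg1 : ∫ r in Ioc a b, |g r| ≤ 1)
    (hs : s ∈ Icc a b) (ht : t ∈ Icc a b) (hzero : v t x₀ = 0) : v s x₀ = 0 := by
  have hc : Continuous fun r => |v r x₀| := (hv.comp (Continuous.prodMk_left x₀)).abs
  obtain ⟨m, hm, hmax⟩ := isCompact_Icc.exists_isMaxOn (nonempty_Icc.2 hab.le) hc.continuousOn
  by_contra hne
  have hpos : 0 < |v m x₀| := (abs_pos.2 hne).trans_le (hmax hs)
  have hM : ∀ᶠ x in nhds x₀, ∀ r ∈ Icc a b, |v r x| < 3 / 2 * |v m x₀| := by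
    refine isCompact_Icc.eventually_forall_of_forall_eventually fun r hr => ?_
    have hcs : Continuous fun z : ℝ × ℝ => |v z.2 z.1| := (hv.comp continuous_swap).abs
    refine hcs.continuousAt.eventually_lt continuousAt_const ?_
    have : |v r x₀| ≤ |v m x₀| := hmax hr
    show |v r x₀| < _
    linarith
  obtain ⟨δ, hδ, hδM⟩ := Metric.eventually_nhds_iff.1 hM
  have := hu.abs_sub_le ha hab hbT hv huv hg hdiff hδ
    (fun r hr x hx => (hδM hx r hr).le) hm ht
  rw [hzero, sub_zero] at this
  nlinarith

/-- A strong solution of `∂ₜ u = (1/2) u ∂ₓ² u` on `[0,T) × ℝ` exactly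
preserves the zero set of its initial data. -/
theorem zero_set_preserved
    (T : ℝ) (u : ℝ → ℝ → ℝ) (hu : IsStrongSolution T u) :
    ∀ t ∈ Ico (0:ℝ) T, {x : ℝ | u t x = 0} = {x : ℝ | u 0 x = 0} := by
  intro t ht
  obtain ⟨⟨-, ⟨hcont, -, -⟩, hweak⟩, hstrong⟩ := hu
  obtain ⟨T', htT', hT'⟩ := exists_between ht.2
  have hT'0 : 0 < T' := ht.1.trans_lt htT'
  obtain ⟨g, hg, hdiff⟩ := (hstrong T' hT'0 hT').2
  set v : ℝ → ℝ → ℝ := fun r x => u (max 0 (min r T')) x with hvdef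
  have hvu : ∀ r ∈ Icc 0 T', u r = v r := fun r hr => by
    simp only [hvdef, min_eq_left hr.2, max_eq_right hr.1]
  have hv : Continuous (Function.uncurry v) := by
    refine hcont.comp_continuous (f := fun z : ℝ × ℝ => (max 0 (min z.1 T'), z.2))
      (by fun_prop) fun z => ⟨⟨le_max_left _ _, max_lt (hT'0.trans hT') ?_⟩, mem_univ _⟩
    exact (min_le_right _ _).trans_lt hT'
  have hdiffv : ∀ᵐ r, r ∈ Ioc 0 T' →
      (∀ x : ℝ, DifferentiableAt ℝ (v r) x ∧ DifferentiableAt ℝ (deriv (v r)) x) ∧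
      (∀ x : ℝ, |deriv (deriv (v r)) x| ≤ g r) := by
    rw [ae_restrict_iff' measurableSet_Ioc] at hdiff
    filter_upwards [hdiff] with r hr hrm
    rw [← hvu r (Ioc_subset_Icc_self hrm)]
    exact hr hrm
  have hgabs : IntervalIntegrable (fun r => |g r|) volume 0 T' :=
    (intervalIntegrable_iff_integrableOn_Icc_of_le hT'0.le).2 hg.abs
  ext x
  have hlocal : ∀ r ∈ Icc 0 T', ∀ r' ∈ Icc 0 T', r < r' → (∫ y in r..r', |g y|) ≤ 1 →
      (v r x = 0 ↔ v r' x = 0) := by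
    intro r hr r' hr' hlt h1
    rw [intervalIntegral.integral_of_le hlt.le] at h1
    have hsub : Icc r r' ⊆ Icc 0 T' := Icc_subset_Icc hr.1 hr'.2
    have hsub' : Ioc r r' ⊆ Ioc 0 T' := Ioc_subset_Ioc hr.1 hr'.2
    have key : ∀ s ∈ Icc r r', ∀ s' ∈ Icc r r', v s' x = 0 → v s x = 0 :=
      fun s hs s' hs' h => hweak.eq_zero_of_integral_le_one hr.1 hlt (hr'.2.trans_lt hT') hv
        (fun y hy => hvu y (hsub hy)) (hg.mono_set (Ioc_subset_Icc_self.trans hsub))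
        (hdiffv.mono fun y hy hym => hy (hsub' hym)) h1 hs hs' h
    exact ⟨key _ (right_mem_Icc.2 hlt.le) _ (left_mem_Icc.2 hlt.le),
      key _ (left_mem_Icc.2 hlt.le) _ (right_mem_Icc.2 hlt.le)⟩
  have hloc : IsLocallyConstant fun r : Icc 0 T' => v r x = 0 := by
    rw [IsLocallyConstant.iff_eventually_eq]
    intro r
    have hG : Continuous fun r : Icc 0 T' => ∫ y in (0 : ℝ)..r, |g y| := by
      have := intervalIntegral.continuousOn_primitive_interval' hgabs left_mem_uIcc
      rw [uIcc_of_le hT'0.le] at this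
      exact this.domRestrict
    have hII : ∀ r r' : Icc 0 T', ∫ y in (r : ℝ)..r', |g y| =
        (∫ y in (0 : ℝ)..r', |g y|) - ∫ y in (0 : ℝ)..r, |g y| := fun r r' => by
      have h0 : ∀ z : Icc 0 T', IntervalIntegrable (fun y => |g y|) volume 0 z := fun z =>
        hgabs.mono_set (by
          rw [uIcc_of_le z.2.1, uIcc_of_le hT'0.le]
          exact Icc_subset_Icc_right z.2.2)
      exact (intervalIntegral.integral_interval_sub_left (h0 r') (h0 r)).symm
    filter_upwards [Metric.continuousAt_iff'.1 hG.continuousAt 1 one_pos] with r' hr'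
    rw [Real.dist_eq, abs_lt] at hr'
    rcases lt_trichotomy (r : ℝ) r' with h | h | h
    · exact propext (hlocal r r.2 r' r'.2 h (by rw [hII]; linarith [hr'.2])).symm
    · rw [Subtype.ext h]
    · exact propext (hlocal r' r'.2 r r.2 h (by rw [hII]; linarith [hr'.1]))
  have : PreconnectedSpace (Icc 0 T') :=
    isPreconnected_iff_preconnectedSpace.1 isPreconnected_Icc
  have hmem : t ∈ Icc 0 T' := ⟨ht.1, htT'.le⟩
  have h0mem : (0 : ℝ) ∈ Icc 0 T' := left_mem_Icc.2 hT'0.le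
  have hend := hloc.apply_eq_of_preconnectedSpace ⟨t, hmem⟩ ⟨0, h0mem⟩
  simp only [mem_ofPred_eq, hvu t hmem, hvu 0 h0mem]
  exact iff_of_eq hend
end
end
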